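/- arXiv:2309.07044 — 3 statements merged into one kernel-verified Lean document; each statement's English description precedes it below -/
import Mathlib

section
/- Let σ : ℝ → ℝ be C¹ and 2π-periodic, and let f ∈ C^∞(ℝ) be compactly supported with f(0) = 0. Then lim_{ℓ→∞} (1/(ℓ+1)) · Σ_{k=1}^{ℓ+1} f(λ_k(V_ℓ(σ))) = (1/(4π)) · ∫_{−π}^{π} ∫_{−1}^{1} f( 4·σ_even(φ) / (π·√(1−ξ²)) ) dξ dφ, where λ_1(V_ℓ(σ)) ≤ … ≤ λ_{ℓ+1}(V_ℓ(σ)) are the eigenvalues of the Hermitian matrix V_ℓ(σ) listed in non-decreasing order with multiplicity. -/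
open Real Filter Finset

/-- γ(x) = Γ(x/2 + 1/2) / Γ(x/2 + 1). -/
noncomputable def gam (x : ℝ) : ℝ := Real.Gamma (x/2 + 1/2) / Real.Gamma (x/2 + 1)

/-- A_{ℓ,m} = sqrt(((2ℓ+1)/π)·γ(ℓ−m)·γ(ℓ+m)) if |m| ≤ ℓ and ℓ−m is even, else 0. -/
noncomputable def Acoef (ℓ : ℕ) (m : ℤ) : ℝ :=
  if |m| ≤ (ℓ : ℤ) ∧ Even ((ℓ : ℤ) - m) then
    Real.sqrt ((2*(ℓ:ℝ)+1)/Real.pi * gam ((ℓ : ℝ) - (m : ℝ)) * gam ((ℓ : ℝ) + (m : ℝ)))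
  else 0

/-- The (ℓ+1)×(ℓ+1) Hermitian matrix V_ℓ(σ) with entries
V_ℓ(σ)_{j,k} = (1/(2π))·A_{ℓ,2j−ℓ}·A_{ℓ,2k−ℓ}·∫_{−π}^{π} σ(φ)·e^{i·2(j−k)·φ} dφ. -/
noncomputable def Vmat (σ : ℝ → ℝ) (ℓ : ℕ) : Matrix (Fin (ℓ+1)) (Fin (ℓ+1)) ℂ :=
  fun j k =>
    (((1/(2*Real.pi)) * Acoef ℓ (2*(j:ℤ) - ℓ) * Acoef ℓ (2*(k:ℤ) - ℓ) : ℝ) : ℂ) *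
      ∫ φ in (-Real.pi)..Real.pi,
        (σ φ : ℂ) * Complex.exp (Complex.I * (((2*((j:ℤ) - (k:ℤ))) : ℤ) : ℂ) * (φ : ℂ))

/-- The Wallis ratio `∏_{i<k} (2i+1)/(2i+2)`, equal to `γ(2k)/√π`. -/
noncomputable def wallisRatio (k : ℕ) : ℝ := ∏ i ∈ range k, ((2 * i + 1) / (2 * i + 2) : ℝ)

theorem wallisRatio_succ (k : ℕ) :
    wallisRatio (k + 1) = wallisRatio k * ((2 * k + 1) / (2 * k + 2)) :=
  prod_range_succ _ _

theorem wallisRatio_pos (k : ℕ) : 0 < wallisRatio k :=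
  prod_pos fun i _ => by positivity

theorem gam_two_mul (k : ℕ) : gam (2 * k) = √π * wallisRatio k := by
  induction k with
  | zero => simp [gam, wallisRatio, ← Real.Gamma_one_half_eq]
  | succ k ih =>
    rw [wallisRatio_succ, ← mul_assoc, ← ih]
    unfold gam
    push_cast
    rw [show (2 * ((k : ℝ) + 1) / 2 + 1 / 2) = (2 * k / 2 + 1 / 2) + 1 by ring,
      show (2 * ((k : ℝ) + 1) / 2 + 1) = (2 * k / 2 + 1) + 1 by ring,
      Real.Gamma_add_one (by positivity), Real.Gamma_add_one (by positivity)]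
    have : Real.Gamma (2 * k / 2 + 1) ≠ 0 := (Real.Gamma_pos_of_pos (by positivity)).ne'
    field_simp

theorem wallisRatio_sq (k : ℕ) : wallisRatio k ^ 2 * ((2 * k + 1) * Wallis.W k) = 1 := by
  induction k with
  | zero => simp [wallisRatio, Wallis.W]
  | succ k ih =>
    rw [wallisRatio_succ, Wallis.W_succ]
    refine Eq.trans ?_ ih
    push_cast
    field_simp
    ring

theorem wallisRatio_sq_mul_le (k : ℕ) : wallisRatio k ^ 2 * (2 * k + 1) ≤ 1 := by
  induction k with
  | zero => simp [wallisRatio]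
  | succ k ih =>
    rw [wallisRatio_succ]
    push_cast
    refine le_trans ?_ ih
    rw [mul_pow, mul_assoc]
    gcongr
    rw [div_pow, div_mul_eq_mul_div, div_le_iff₀ (by positivity)]
    have : (0 : ℝ) ≤ k := k.cast_nonneg
    nlinarith

theorem wallisRatio_le_one (k : ℕ) : wallisRatio k ≤ 1 := by
  have h := wallisRatio_sq_mul_le k
  have h0 := wallisRatio_pos k
  have : (0 : ℝ) ≤ k := k.cast_nonneg
  nlinarith [mul_nonneg (sq_nonneg (wallisRatio k)) this]

/-- The Wallis ratio is decreasing, slowly. -/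
theorem wallisRatio_sub_le (p d : ℕ) :
    wallisRatio (p + d) ≤ wallisRatio p ∧
      wallisRatio p - wallisRatio (p + d) ≤ wallisRatio p * (d / (2 * p + 2)) := by
  induction d with
  | zero => simp
  | succ d ih =>
    obtain ⟨h1, h2⟩ := ih
    have hpos := wallisRatio_pos (p + d)
    have hstep : wallisRatio (p + d) - wallisRatio (p + (d + 1))
        = wallisRatio (p + d) / (2 * (p + d) + 2) := by
      rw [← add_assoc, wallisRatio_succ]
      push_cast
      field_simp
      ring
    have hle : wallisRatio (p + d) / (2 * (p + d) + 2) ≤ wallisRatio p / (2 * p + 2) := by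
      have : (0 : ℝ) ≤ d := d.cast_nonneg
      gcongr
      · exact (wallisRatio_pos p).le
      · linarith
    have hnn : 0 ≤ wallisRatio (p + d) / (2 * ((p : ℝ) + d) + 2) := by positivity
    refine ⟨by linarith, ?_⟩
    have : wallisRatio p * (((d + 1 : ℕ) : ℝ) / (2 * p + 2))
        = wallisRatio p * (d / (2 * p + 2)) + wallisRatio p / (2 * p + 2) := by
      push_cast
      ring
    rw [this]
    linarith

theorem Acoef_nonneg (ℓ : ℕ) (m : ℤ) : 0 ≤ Acoef ℓ m := by
  unfold Acoef
  split_ifs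
  · exact Real.sqrt_nonneg _
  · exact le_rfl

theorem Acoef_sq {ℓ k : ℕ} (hk : k ≤ ℓ) :
    Acoef ℓ (2 * (k : ℤ) - ℓ) ^ 2 = (2 * ℓ + 1) * (wallisRatio k * wallisRatio (ℓ - k)) := by
  have h1 : |2 * (k : ℤ) - ℓ| ≤ (ℓ : ℤ) ∧ Even ((ℓ : ℤ) - (2 * (k : ℤ) - ℓ)) := by
    refine ⟨abs_le.2 ⟨by omega, by omega⟩, ⟨ℓ - k, by ring⟩⟩
  have e1 : (ℓ : ℝ) - ((2 * (k : ℤ) - ℓ : ℤ) : ℝ) = 2 * ((ℓ - k : ℕ) : ℝ) := by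
    push_cast [Nat.cast_sub hk]; ring
  have e2 : (ℓ : ℝ) + ((2 * (k : ℤ) - ℓ : ℤ) : ℝ) = 2 * (k : ℝ) := by
    push_cast; ring
  have p1 := wallisRatio_pos k
  have p2 := wallisRatio_pos (ℓ - k)
  unfold Acoef
  rw [if_pos h1, e1, e2, gam_two_mul, gam_two_mul, Real.sq_sqrt (by positivity)]
  have : √π * √π = π := Real.mul_self_sqrt pi_pos.le
  have hpi := pi_pos.ne'
  calc _ = (2 * ℓ + 1) / π * (wallisRatio k * wallisRatio (ℓ - k)) * (√π * √π) := by ring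
    _ = _ := by rw [this]; field_simp

theorem Acoef_sq_le {ℓ k : ℕ} (hk : k ≤ ℓ) :
    Acoef ℓ (2 * (k : ℤ) - ℓ) ^ 2 ≤ 2 * √((ℓ : ℝ) + 1) := by
  have key : ∀ p q : ℕ, (ℓ : ℝ) ≤ 2 * p →
      (2 * (ℓ : ℝ) + 1) * (wallisRatio p * wallisRatio q) ≤ 2 * √((ℓ : ℝ) + 1) := by
    intro p q hp
    have h1 := wallisRatio_sq_mul_le p
    have h2 := wallisRatio_le_one q
    have h3 := wallisRatio_pos p
    have h4 : wallisRatio p * √((ℓ : ℝ) + 1) ≤ 1 := by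
      refine abs_le_of_sq_le_sq' ?_ zero_le_one |>.2
      rw [mul_pow, Real.sq_sqrt (by positivity)]
      nlinarith [sq_nonneg (wallisRatio p)]
    have h5 : √((ℓ : ℝ) + 1) * √((ℓ : ℝ) + 1) = ℓ + 1 := Real.mul_self_sqrt (by positivity)
    calc (2 * (ℓ : ℝ) + 1) * (wallisRatio p * wallisRatio q)
        ≤ (2 * (ℓ + 1)) * (wallisRatio p * 1) := by
          gcongr
          · exact mul_nonneg h3.le (wallisRatio_pos q).le
          · linarith
      _ = 2 * √((ℓ : ℝ) + 1) * (wallisRatio p * √((ℓ : ℝ) + 1)) := by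
          linear_combination (-2 * wallisRatio p) * h5
      _ ≤ 2 * √((ℓ : ℝ) + 1) * 1 := by gcongr
      _ = _ := mul_one _
  rw [Acoef_sq hk]
  rcases le_total ℓ (2 * k) with h | h
  · exact key _ _ (by exact_mod_cast h)
  · rw [mul_comm (wallisRatio k)]
    refine key _ _ ?_
    have : ℓ ≤ 2 * (ℓ - k) := by omega
    exact_mod_cast this

/-- In the bulk the squared coefficients vary slowly. -/
theorem abs_Acoef_sq_sub_le {ℓ a d : ℕ} {δ M : ℝ} (hδ : 0 < δ) (hk : a + d ≤ ℓ)
    (ha : δ * (ℓ + 1) ≤ a) (hb : δ * (ℓ + 1) ≤ ((ℓ - (a + d) : ℕ) : ℝ)) (hd : (d : ℝ) ≤ M) :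
    |Acoef ℓ (2 * ((a + d : ℕ) : ℤ) - ℓ) ^ 2 - Acoef ℓ (2 * (a : ℤ) - ℓ) ^ 2|
      ≤ M / (δ ^ 2 * (ℓ + 1)) := by
  rw [Acoef_sq hk, Acoef_sq (le_trans (Nat.le_add_right _ _) hk)]
  obtain ⟨b, hb'⟩ : ∃ b, ℓ - (a + d) = b := ⟨_, rfl⟩
  have hb2 : ℓ - a = b + d := by omega
  rw [hb'] at hb
  rw [hb2, hb']
  set n : ℝ := (ℓ : ℝ) + 1 with hn
  have hn0 : 0 < n := by positivity
  obtain ⟨h1, h2⟩ := wallisRatio_sub_le a d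
  obtain ⟨h3, h4⟩ := wallisRatio_sub_le b d
  have pa := wallisRatio_pos a
  have pb := wallisRatio_pos b
  have pad := wallisRatio_pos (a + d)
  have pbd := wallisRatio_pos (b + d)
  have hM : 0 ≤ M := le_trans d.cast_nonneg hd
  have hbd : ∀ p : ℕ, δ * n ≤ p → (d : ℝ) / (2 * p + 2) ≤ M / (2 * (δ * n)) := by
    intro p hp
    gcongr
    linarith
  have hw : wallisRatio a * wallisRatio b ≤ 1 / (2 * (δ * n)) := by
    rw [le_div_iff₀ (by positivity)]
    have e1 := wallisRatio_sq_mul_le a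
    have e2 := wallisRatio_sq_mul_le b
    have g1 : wallisRatio a ^ 2 * (2 * (δ * n)) ≤ 1 := by nlinarith [sq_nonneg (wallisRatio a)]
    have g2 : wallisRatio b ^ 2 * (2 * (δ * n)) ≤ 1 := by nlinarith [sq_nonneg (wallisRatio b)]
    nlinarith [sq_nonneg (wallisRatio a - wallisRatio b), mul_pos hδ hn0,
      mul_nonneg (sq_nonneg (wallisRatio a - wallisRatio b)) (mul_pos hδ hn0).le]
  have hA : |wallisRatio (a + d) * wallisRatio b - wallisRatio a * wallisRatio (b + d)|
      ≤ wallisRatio a * wallisRatio b * (M / (2 * (δ * n))) := by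
    have i1 : wallisRatio a - wallisRatio (a + d) ≤ wallisRatio a * (M / (2 * (δ * n))) :=
      h2.trans (mul_le_mul_of_nonneg_left (hbd a ha) pa.le)
    have i2 : wallisRatio b - wallisRatio (b + d) ≤ wallisRatio b * (M / (2 * (δ * n))) :=
      h4.trans (mul_le_mul_of_nonneg_left (hbd b hb) pb.le)
    rw [abs_le]
    constructor <;> nlinarith
  rw [← mul_sub, abs_mul, abs_of_nonneg (by positivity : (0 : ℝ) ≤ 2 * ℓ + 1)]
  calc (2 * (ℓ : ℝ) + 1) *
        |wallisRatio (a + d) * wallisRatio b - wallisRatio a * wallisRatio (b + d)|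
      ≤ (2 * n) * (1 / (2 * (δ * n)) * (M / (2 * (δ * n)))) := by
        gcongr
        · linarith
        · exact hA.trans (by gcongr)
    _ ≤ M / (δ ^ 2 * n) := by
        rw [show (2 * n) * (1 / (2 * (δ * n)) * (M / (2 * (δ * n)))) = M / (δ ^ 2 * n) / 2 by
          field_simp]
        exact half_le_self (by positivity)

theorem tendsto_wallisRatio_sq : Tendsto (fun k : ℕ => wallisRatio k ^ 2 * (2 * k + 1)) atTop
    (nhds (2 / π)) := by
  have h := Real.tendsto_prod_pi_div_two
  have h' : Tendsto Wallis.W atTop (nhds (π / 2)) := h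
  have := h'.inv₀ (by positivity)
  rw [inv_div] at this
  refine this.congr fun k => ?_
  have := wallisRatio_sq k
  have hW := (Wallis.W_pos k).ne'
  rw [inv_eq_iff_eq_inv, eq_comm, inv_eq_of_mul_eq_one_right]
  linarith

theorem tendsto_Acoef_sq {x : ℝ} (hx0 : 0 < x) (hx1 : x < 1) :
    Tendsto (fun ℓ : ℕ => Acoef ℓ (2 * (⌊((ℓ : ℝ) + 1) * x⌋₊ : ℤ) - ℓ) ^ 2) atTop
      (nhds (2 / (π * √(x * (1 - x))))) := by
  set a : ℕ → ℕ := fun ℓ => ⌊((ℓ : ℝ) + 1) * x⌋₊ with ha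
  have hal : ∀ ℓ, a ℓ ≤ ℓ := by
    intro ℓ
    have : a ℓ < ℓ + 1 := by
      rw [ha, Nat.floor_lt (by positivity)]
      push_cast
      nlinarith [(ℓ.cast_nonneg : (0 : ℝ) ≤ ℓ)]
    omega
  have hcast : Tendsto (fun ℓ : ℕ => (ℓ : ℝ) + 1) atTop atTop :=
    tendsto_atTop_add_const_right _ _ tendsto_natCast_atTop_atTop
  have hinv : Tendsto (fun ℓ : ℕ => 1 / ((ℓ : ℝ) + 1)) atTop (nhds 0) :=
    tendsto_one_div_add_atTop_nhds_zero_nat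
  have hquot : Tendsto (fun ℓ : ℕ => (a ℓ : ℝ) / ((ℓ : ℝ) + 1)) atTop (nhds x) := by
    have := (tendsto_nat_floor_mul_div_atTop hx0.le).comp hcast
    refine this.congr fun ℓ => ?_
    simp [ha, mul_comm]
  have hquot2 : Tendsto (fun ℓ : ℕ => ((ℓ - a ℓ : ℕ) : ℝ) / ((ℓ : ℝ) + 1)) atTop
      (nhds (1 - x)) := by
    have : Tendsto (fun ℓ : ℕ => 1 - 1 / ((ℓ : ℝ) + 1) - (a ℓ : ℝ) / ((ℓ : ℝ) + 1)) atTop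
      (nhds (1 - 0 - x)) := (tendsto_const_nhds.sub hinv).sub hquot
    rw [sub_zero] at this
    refine this.congr fun ℓ => ?_
    rw [Nat.cast_sub (hal ℓ)]
    field_simp
    ring
  have hlim : ∀ (c : ℕ → ℕ) (y : ℝ), 0 < y →
      Tendsto (fun ℓ : ℕ => (c ℓ : ℝ) / ((ℓ : ℝ) + 1)) atTop (nhds y) →
      Tendsto (fun ℓ : ℕ => wallisRatio (c ℓ) ^ 2 * ((ℓ : ℝ) + 1)) atTop
        (nhds (2 / π / (2 * y))) := by
    intro c y hy hc
    have hct : Tendsto c atTop atTop := by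
      have : Tendsto (fun ℓ => (c ℓ : ℝ)) atTop atTop := by
        refine (hcast.atTop_mul_pos hy hc).congr fun ℓ => ?_
        field_simp
      exact tendsto_natCast_atTop_iff.1 this
    have h1 := tendsto_wallisRatio_sq.comp hct
    have h2 : Tendsto (fun ℓ : ℕ => 2 * ((c ℓ : ℝ) / ((ℓ : ℝ) + 1)) + 1 / ((ℓ : ℝ) + 1)) atTop
        (nhds (2 * y + 0)) := (hc.const_mul 2).add hinv
    rw [add_zero] at h2
    refine (h1.div h2 (by positivity)).congr fun ℓ => ?_
    simp only [Function.comp, Pi.div_apply]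
    field_simp
  have hprod := ((hlim a x hx0 hquot).mul (hlim _ (1 - x) (by linarith) hquot2)).sqrt
  have h2 : Tendsto (fun ℓ : ℕ => 2 - 1 / ((ℓ : ℝ) + 1)) atTop (nhds (2 - 0)) :=
    tendsto_const_nhds.sub hinv
  have := h2.mul hprod
  have hval : (2 - 0) * √(2 / π / (2 * x) * (2 / π / (2 * (1 - x)))) =
      2 / (π * √(x * (1 - x))) := by
    have : 2 / π / (2 * x) * (2 / π / (2 * (1 - x))) = (1 / π) ^ 2 * (x * (1 - x))⁻¹ := by
      have : 1 - x ≠ 0 := by linarith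
      field_simp
    rw [this, Real.sqrt_mul (by positivity), Real.sqrt_sq (by positivity), Real.sqrt_inv]
    field_simp
    ring
  rw [hval] at this
  refine this.congr fun ℓ => ?_
  rw [Acoef_sq (hal ℓ)]
  have p1 := wallisRatio_pos (a ℓ)
  have p2 := wallisRatio_pos (ℓ - a ℓ)
  rw [show wallisRatio (a ℓ) ^ 2 * ((ℓ : ℝ) + 1) * (wallisRatio (ℓ - a ℓ) ^ 2 * ((ℓ : ℝ) + 1))
    = (wallisRatio (a ℓ) * wallisRatio (ℓ - a ℓ) * ((ℓ : ℝ) + 1)) ^ 2 by ring,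
    Real.sqrt_sq (by positivity)]
  field_simp
  ring

open scoped Matrix

/-- For a unit vector `u`, the average of `f` against the spectral measure of `u` is close to `f c`
as soon as `u` is an approximate eigenvector with eigenvalue `c`. -/
theorem abs_sum_eigenvalues_sub_le {ι : Type*} [Fintype ι] [DecidableEq ι] {H : Matrix ι ι ℂ}
    (hH : H.IsHermitian) {f : ℝ → ℝ} {L : ℝ} (hL0 : 0 ≤ L)
    (hL : ∀ x y, |f x - f y| ≤ L * |x - y|)
    {u : ι → ℂ} (hu : ‖WithLp.toLp 2 u‖ = 1) (c : ℝ) :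
    |∑ k, ‖inner ℂ (hH.eigenvectorBasis k) (WithLp.toLp 2 u)‖ ^ 2 * f (hH.eigenvalues k) - f c|
      ≤ L * ‖WithLp.toLp 2 (H *ᵥ u - (c : ℂ) • u)‖ := by
  set b := hH.eigenvectorBasis with hb
  set p : ι → ℝ := fun k => ‖inner ℂ (b k) (WithLp.toLp 2 u)‖ with hp
  have hp1 : ∑ k, p k ^ 2 = 1 := by
    rw [hp, b.sum_sq_norm_inner_right, hu, one_pow]
  have hin : ∀ k, inner ℂ (b k) (WithLp.toLp 2 (H *ᵥ u - (c : ℂ) • u))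
      = ((hH.eigenvalues k - c : ℝ) : ℂ) * inner ℂ (b k) (WithLp.toLp 2 u) := by
    intro k
    have hs := (Matrix.isSymmetric_toEuclideanLin_iff.mpr hH) (b k) (WithLp.toLp 2 u)
    have h1 : Matrix.toEuclideanLin H (b k) = (hH.eigenvalues k : ℂ) • b k := by
      have := hH.mulVec_eigenvectorBasis k
      apply (WithLp.ofLp_injective 2)
      simpa [Matrix.toLpLin_apply] using this
    have h2 : Matrix.toEuclideanLin H (WithLp.toLp 2 u) = WithLp.toLp 2 (H *ᵥ u) := by
      simp [Matrix.toLpLin_apply]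
    rw [h1, h2, inner_smul_left] at hs
    rw [WithLp.toLp_sub, WithLp.toLp_smul, inner_sub_right, inner_smul_right, ← hs]
    simp
    ring
  have hnorm : ‖WithLp.toLp 2 (H *ᵥ u - (c : ℂ) • u)‖ ^ 2
      = ∑ k, (p k * |hH.eigenvalues k - c|) ^ 2 := by
    rw [← b.sum_sq_norm_inner_right]
    refine sum_congr rfl fun k _ => ?_
    rw [hin, norm_mul, Complex.norm_real, Real.norm_eq_abs, mul_comm]
  have hfc : f c = ∑ k, p k ^ 2 * f c := by rw [← sum_mul, hp1, one_mul]
  rw [hfc, ← sum_sub_distrib]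
  calc |∑ k, (p k ^ 2 * f (hH.eigenvalues k) - p k ^ 2 * f c)|
      ≤ ∑ k, |p k ^ 2 * f (hH.eigenvalues k) - p k ^ 2 * f c| := abs_sum_le_sum_abs _ _
    _ ≤ ∑ k, L * (p k * (p k * |hH.eigenvalues k - c|)) := by
        refine sum_le_sum fun k _ => ?_
        rw [← mul_sub, abs_mul, abs_of_nonneg (sq_nonneg _)]
        calc _ ≤ p k ^ 2 * (L * |hH.eigenvalues k - c|) := by gcongr; exact hL _ _
          _ = _ := by ring
    _ = L * ∑ k, p k * (p k * |hH.eigenvalues k - c|) := by rw [mul_sum]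
    _ ≤ L * ‖WithLp.toLp 2 (H *ᵥ u - (c : ℂ) • u)‖ := by
        gcongr
        refine abs_le_of_sq_le_sq' ?_ (norm_nonneg _) |>.2
        refine (sum_mul_sq_le_sq_mul_sq _ _ _).trans ?_
        rw [hp1, hnorm, one_mul]

/-- The exponential `φ ↦ e^{2imφ}`. -/
noncomputable def expEven (m : ℤ) (φ : ℝ) : ℂ := Complex.exp (Complex.I * ((2 * m : ℤ) : ℂ) * φ)

@[fun_prop]
theorem continuous_expEven (m : ℤ) : Continuous (expEven m) := by
  unfold expEven; fun_prop

theorem expEven_eq (m : ℤ) (φ : ℝ) :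
    expEven m φ = Complex.exp (((2 * m * φ : ℝ) : ℂ) * Complex.I) := by
  unfold expEven; congr 1; push_cast; ring

@[simp]
theorem norm_expEven (m : ℤ) (φ : ℝ) : ‖expEven m φ‖ = 1 := by
  rw [expEven_eq, Complex.norm_exp_ofReal_mul_I]

theorem expEven_add (m k : ℤ) (φ : ℝ) : expEven (m + k) φ = expEven m φ * expEven k φ := by
  rw [expEven, expEven, expEven, ← Complex.exp_add]; congr 1; push_cast; ring

theorem expEven_mul_neg (m : ℤ) (φ ψ : ℝ) :
    expEven m φ * expEven (-m) ψ = expEven (-m) (ψ - φ) := by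
  rw [expEven, expEven, expEven, ← Complex.exp_add]; congr 1; push_cast; ring

theorem expEven_neg_natCast (d : ℕ) (φ : ℝ) : expEven (-(d : ℤ)) φ = expEven (-1) φ ^ d := by
  rw [expEven, expEven, ← Complex.exp_nat_mul]; congr 1; push_cast; ring

theorem conj_expEven (m : ℤ) (φ : ℝ) : (starRingEnd ℂ) (expEven m φ) = expEven (-m) φ := by
  rw [expEven, expEven, ← Complex.exp_conj, map_mul, map_mul, Complex.conj_I, Complex.conj_ofReal,
    map_intCast]
  congr 1
  push_cast
  ring

theorem expEven_add_pi (m : ℤ) (φ : ℝ) : expEven m (φ + π) = expEven m φ := by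
  rw [expEven, expEven, Complex.exp_eq_exp_iff_exists_int]
  exact ⟨m, by push_cast; ring⟩

theorem integral_expEven (m : ℤ) :
    ∫ φ in (-π)..π, expEven m φ = if m = 0 then ((2 * π : ℝ) : ℂ) else 0 := by
  split_ifs with h
  · subst h
    simp [expEven]
    ring
  · have h1 : expEven m (-π) = expEven m π := by
      rw [← expEven_add_pi m (-π), neg_add_cancel, ← expEven_add_pi m 0, zero_add]
    unfold expEven at h1 ⊢
    rw [integral_exp_mul_complex, h1, sub_self, zero_div]
    simpa using h

theorem integral_norm_sq_sum_expEven {ι : Type*} [Fintype ι] {m : ι → ℤ}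
    (hm : Function.Injective m) (v : ι → ℂ) :
    ∫ φ in (-π)..π, ‖∑ k, v k * expEven (m k) φ‖ ^ 2 = 2 * π * ∑ k, ‖v k‖ ^ 2 := by
  classical
  have h1 : ∀ φ, ((‖∑ k, v k * expEven (m k) φ‖ ^ 2 : ℝ) : ℂ)
      = ∑ j, ∑ k, v j * (starRingEnd ℂ) (v k) * expEven (m j - m k) φ := by
    intro φ
    rw [Complex.ofReal_pow, ← Complex.mul_conj', map_sum, sum_mul_sum]
    refine sum_congr rfl fun j _ => sum_congr rfl fun k _ => ?_
    rw [map_mul, conj_expEven, sub_eq_add_neg, expEven_add]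
    ring
  have h2 : ((∫ φ in (-π)..π, ‖∑ k, v k * expEven (m k) φ‖ ^ 2 : ℝ) : ℂ)
      = ((2 * π * ∑ k, ‖v k‖ ^ 2 : ℝ) : ℂ) := by
    rw [← intervalIntegral.integral_ofReal]
    simp_rw [h1]
    rw [intervalIntegral.integral_finsetSum
      (fun j _ => (Continuous.intervalIntegrable (by fun_prop) _ _))]
    have : ∀ j, ∫ φ in (-π)..π, ∑ k, v j * (starRingEnd ℂ) (v k) * expEven (m j - m k) φ
        = ((2 * π : ℝ) : ℂ) * ((‖v j‖ ^ 2 : ℝ) : ℂ) := by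
      intro j
      rw [intervalIntegral.integral_finsetSum
        (fun j _ => (Continuous.intervalIntegrable (by fun_prop) _ _)),
        sum_eq_single j]
      · rw [intervalIntegral.integral_const_mul, integral_expEven, if_pos (sub_self _),
          Complex.mul_conj']
        push_cast
        ring
      · intro k _ hk
        rw [intervalIntegral.integral_const_mul, integral_expEven, if_neg, mul_zero]
        exact fun h => hk (hm (sub_eq_zero.1 h).symm)
      · simp
    simp_rw [this]
    push_cast
    rw [mul_sum]
  exact_mod_cast h2

/-- Bessel's inequality for the exponentials `e^{2imφ}`. -/
theorem sum_norm_sq_integral_le {ι : Type*} [Fintype ι] {m : ι → ℤ}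
    (hm : Function.Injective m) {h : ℝ → ℂ} (hh : Continuous h) :
    ∑ j, ‖(1 / (2 * π) : ℂ) * ∫ φ in (-π)..π, h φ * expEven (m j) φ‖ ^ 2
      ≤ 1 / (2 * π) * ∫ φ in (-π)..π, ‖h φ‖ ^ 2 := by
  set w : ι → ℂ := fun j => (1 / (2 * π) : ℂ) * ∫ φ in (-π)..π, h φ * expEven (m j) φ with hw
  set g : ℝ → ℂ := fun φ => ∑ j, (starRingEnd ℂ) (w j) * expEven (m j) φ with hg
  have hgc : Continuous g := by fun_prop
  have hpi := pi_pos
  have hP : ∫ φ in (-π)..π, ‖g φ‖ ^ 2 = 2 * π * ∑ k, ‖w k‖ ^ 2 := by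
    rw [hg, integral_norm_sq_sum_expEven hm]
    simp
  have h1 : ((∑ j, ‖w j‖ ^ 2 : ℝ) : ℂ) = (1 / (2 * π) : ℂ) * ∫ φ in (-π)..π, h φ * g φ := by
    simp_rw [hg, mul_sum]
    rw [intervalIntegral.integral_finsetSum
      (fun j _ => (Continuous.intervalIntegrable (by fun_prop) _ _)), mul_sum]
    push_cast
    refine sum_congr rfl fun j _ => ?_
    rw [← Complex.mul_conj', mul_comm]
    conv_lhs => rw [hw]
    simp only
    rw [mul_left_comm, ← intervalIntegral.integral_const_mul]
    congr 2
    ext φ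
    ring
  have h2 : ∑ j, ‖w j‖ ^ 2 ≤ 1 / (2 * π) * ∫ φ in (-π)..π, (‖h φ‖ ^ 2 + ‖g φ‖ ^ 2) / 2 := by
    have e1 : ∑ j, ‖w j‖ ^ 2 = ‖((∑ j, ‖w j‖ ^ 2 : ℝ) : ℂ)‖ := by
      rw [Complex.norm_real, Real.norm_of_nonneg (by positivity)]
    rw [e1, h1, norm_mul]
    have e2 : ‖(1 / (2 * π) : ℂ)‖ = 1 / (2 * π) := by
      simp [abs_of_pos hpi]
    rw [e2]
    gcongr
    refine intervalIntegral.norm_integral_le_of_norm_le (by linarith) ?_ ?_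
    · refine Filter.Eventually.of_forall fun φ _ => ?_
      rw [norm_mul]
      nlinarith [sq_nonneg (‖h φ‖ - ‖g φ‖)]
    · exact Continuous.intervalIntegrable (by fun_prop) _ _
  rw [intervalIntegral.integral_div, intervalIntegral.integral_add
    (Continuous.intervalIntegrable (by fun_prop) _ _)
    (Continuous.intervalIntegrable (by fun_prop) _ _), hP] at h2
  have h3 : 1 / (2 * π) * (((∫ φ in (-π)..π, ‖h φ‖ ^ 2) + 2 * π * ∑ k, ‖w k‖ ^ 2) / 2)
      = (1 / (2 * π) * ∫ φ in (-π)..π, ‖h φ‖ ^ 2) / 2 + (∑ k, ‖w k‖ ^ 2) / 2 := by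
    field_simp
  rw [h3] at h2
  linarith

/-- The `n × n` Toeplitz matrix of the Fourier coefficients of even order of `s`. -/
noncomputable def evenToeplitz (s : ℝ → ℝ) (n : ℕ) : Matrix (Fin n) (Fin n) ℂ :=
  fun j k => (1 / (2 * π) : ℂ) * ∫ φ in (-π)..π, (s φ : ℂ) * expEven ((j : ℤ) - (k : ℤ)) φ

/-- The trigonometric polynomial `∑ v_k e^{-2ikφ}`. -/
noncomputable def trigPoly {n : ℕ} (v : Fin n → ℂ) (φ : ℝ) : ℂ :=
  ∑ k, v k * expEven (-(k : ℤ)) φ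

@[fun_prop]
theorem continuous_trigPoly {n : ℕ} (v : Fin n → ℂ) : Continuous (trigPoly v) := by
  unfold trigPoly; fun_prop

theorem integral_norm_sq_trigPoly {n : ℕ} (v : Fin n → ℂ) :
    ∫ φ in (-π)..π, ‖trigPoly v φ‖ ^ 2 = 2 * π * ‖WithLp.toLp 2 v‖ ^ 2 := by
  rw [EuclideanSpace.norm_sq_eq]
  exact integral_norm_sq_sum_expEven (fun i j h => by simpa [Fin.ext_iff] using h) v

theorem evenToeplitz_mulVec_sub {s : ℝ → ℝ} (hs : Continuous s) {n : ℕ} (v : Fin n → ℂ) (c : ℝ)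
    (j : Fin n) :
    (evenToeplitz s n *ᵥ v - (c : ℂ) • v) j
      = (1 / (2 * π) : ℂ) * ∫ φ in (-π)..π, (((s φ - c : ℝ) : ℂ) * trigPoly v φ) * expEven j φ := by
  have hpi : (π : ℂ) ≠ 0 := by exact_mod_cast pi_pos.ne'
  have h1 : ∀ φ, (((s φ - c : ℝ) : ℂ) * trigPoly v φ) * expEven j φ
      = ∑ k, (v k * ((s φ : ℂ) * expEven ((j : ℤ) - (k : ℤ)) φ)
          - (c * v k) * expEven ((j : ℤ) - (k : ℤ)) φ) := by
    intro φ
    rw [trigPoly, mul_sum, sum_mul]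
    refine sum_congr rfl fun k _ => ?_
    rw [sub_eq_add_neg (j : ℤ), expEven_add]
    push_cast
    ring
  simp_rw [h1]
  rw [intervalIntegral.integral_finsetSum
      (fun j _ => (Continuous.intervalIntegrable (by fun_prop) _ _)), mul_sum]
  have h2 : ∀ k : Fin n, (1 / (2 * π) : ℂ) * ∫ φ in (-π)..π,
        (v k * ((s φ : ℂ) * expEven ((j : ℤ) - (k : ℤ)) φ)
          - (c * v k) * expEven ((j : ℤ) - (k : ℤ)) φ)
      = evenToeplitz s n j k * v k - if k = j then (c : ℂ) * v k else 0 := by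
    intro k
    rw [intervalIntegral.integral_sub (Continuous.intervalIntegrable (by fun_prop) _ _)
      (Continuous.intervalIntegrable (by fun_prop) _ _), intervalIntegral.integral_const_mul,
      intervalIntegral.integral_const_mul, integral_expEven, evenToeplitz]
    by_cases hk : k = j
    · subst hk
      simp
      field_simp
    · have : ((j : ℤ) - (k : ℤ)) ≠ 0 := by
        intro h
        apply hk
        ext
        omega
      rw [if_neg this, if_neg hk]
      ring
  simp_rw [h2]
  rw [sum_sub_distrib]
  simp [Matrix.mulVec, dotProduct]

theorem norm_evenToeplitz_mulVec_sub_le {s : ℝ → ℝ} (hs : Continuous s) {n : ℕ} (v : Fin n → ℂ)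
    (c : ℝ) :
    ‖WithLp.toLp 2 (evenToeplitz s n *ᵥ v - (c : ℂ) • v)‖ ^ 2
      ≤ 1 / (2 * π) * ∫ φ in (-π)..π, ‖((s φ - c : ℝ) : ℂ) * trigPoly v φ‖ ^ 2 := by
  rw [EuclideanSpace.norm_sq_eq]
  simp only [evenToeplitz_mulVec_sub hs]
  exact sum_norm_sq_integral_le (m := fun j : Fin n => (j : ℤ))
    (fun i j h => by simpa [Fin.ext_iff] using h) (by fun_prop)

theorem norm_evenToeplitz_mulVec_le {s : ℝ → ℝ} (hs : Continuous s) {K : ℝ}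
    (hK : ∀ φ, |s φ| ≤ K) {n : ℕ} (v : Fin n → ℂ) :
    ‖WithLp.toLp 2 (evenToeplitz s n *ᵥ v)‖ ≤ K * ‖WithLp.toLp 2 v‖ := by
  have hK0 : 0 ≤ K := (abs_nonneg _).trans (hK 0)
  have hpi := pi_pos
  have h := norm_evenToeplitz_mulVec_sub_le hs v 0
  simp only [Complex.ofReal_zero, zero_smul, sub_zero] at h
  refine abs_le_of_sq_le_sq' (h.trans ?_) (by positivity) |>.2
  calc 1 / (2 * π) * ∫ φ in (-π)..π, ‖(s φ : ℂ) * trigPoly v φ‖ ^ 2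
      ≤ 1 / (2 * π) * ∫ φ in (-π)..π, K ^ 2 * ‖trigPoly v φ‖ ^ 2 := by
        gcongr
        refine intervalIntegral.integral_mono_on (by linarith)
          (Continuous.intervalIntegrable (by fun_prop) _ _)
          (Continuous.intervalIntegrable (by fun_prop) _ _) fun φ _ => ?_
        rw [norm_mul, mul_pow, Complex.norm_real, Real.norm_eq_abs]
        gcongr
        exact hK φ
    _ = (K * ‖WithLp.toLp 2 v‖) ^ 2 := by
        rw [intervalIntegral.integral_const_mul, integral_norm_sq_trigPoly]
        field_simp

theorem norm_evenToeplitz_mulVec_sub_le_of_bound {s : ℝ → ℝ} (hs : Continuous s) {n : ℕ}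
    (v : Fin n → ℂ) {c C : ℝ} (hC : 0 ≤ C) (h : ∀ φ, |s φ - c| * ‖trigPoly v φ‖ ≤ C) :
    ‖WithLp.toLp 2 (evenToeplitz s n *ᵥ v - (c : ℂ) • v)‖ ≤ C := by
  have hpi := pi_pos
  refine abs_le_of_sq_le_sq' ((norm_evenToeplitz_mulVec_sub_le hs v c).trans ?_) hC |>.2
  calc 1 / (2 * π) * ∫ φ in (-π)..π, ‖((s φ - c : ℝ) : ℂ) * trigPoly v φ‖ ^ 2
      ≤ 1 / (2 * π) * ∫ φ in (-π)..π, C ^ 2 := by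
        gcongr
        refine intervalIntegral.integral_mono_on (by linarith)
          (Continuous.intervalIntegrable (by fun_prop) _ _)
          (Continuous.intervalIntegrable (by fun_prop) _ _) fun φ _ => ?_
        rw [norm_mul, Complex.norm_real, Real.norm_eq_abs]
        gcongr
        exact h φ
    _ = C ^ 2 := by
        rw [intervalIntegral.integral_const]
        simp
        field_simp
        ring

/-- The wave packet of length `M` starting at the (cyclic) position `a` with frequency `φ`. -/
noncomputable def packet {ℓ : ℕ} (M : ℕ) (a : Fin (ℓ + 1)) (φ : ℝ) : Fin (ℓ + 1) → ℂ :=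
  fun j => ((if (j - a).val < M then 1 / √M else 0 : ℝ) : ℂ) * expEven j φ

theorem card_filter_val_lt {n M : ℕ} (hM : M ≤ n) :
    (#{d : Fin n | d.val < M}) = M := by
  rw [Fin.card_filter_val_lt, min_eq_right hM]

theorem sum_window {ℓ M : ℕ} (hM0 : 0 < M) (hM : M ≤ ℓ + 1) :
    ∑ d : Fin (ℓ + 1), (if d.val < M then 1 / √M else 0 : ℝ) ^ 2 = 1 := by
  have hM' : (0 : ℝ) < M := by exact_mod_cast hM0
  simp_rw [ite_pow, zero_pow two_ne_zero]
  rw [← sum_filter, sum_const, card_filter_val_lt hM, div_pow, Real.sq_sqrt hM'.le]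
  simp [hM'.ne']

theorem norm_packet {ℓ M : ℕ} (hM0 : 0 < M) (hM : M ≤ ℓ + 1) (a : Fin (ℓ + 1)) (φ : ℝ) :
    ‖WithLp.toLp 2 (packet M a φ)‖ = 1 := by
  rw [← sq_eq_sq₀ (norm_nonneg _) zero_le_one, EuclideanSpace.norm_sq_eq, one_pow,
    ← sum_window hM0 hM, eq_comm, ← Equiv.sum_comp (Equiv.subRight a)]
  refine sum_congr rfl fun j _ => ?_
  simp [packet]

theorem sum_shift_window {ℓ M : ℕ} (hM0 : 0 < M) (hM : M ≤ ℓ + 1) (j : Fin (ℓ + 1)) :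
    ∑ a : Fin (ℓ + 1), (if (j - a).val < M then 1 / √M else 0 : ℝ) ^ 2 = 1 := by
  rw [← Equiv.sum_comp (Equiv.subLeft j)]
  simpa using sum_window hM0 hM

theorem norm_one_sub_expEven (ψ : ℝ) : ‖expEven (-1) ψ - 1‖ = 2 * |sin ψ| := by
  have : expEven (-1) ψ = Complex.exp (Complex.I * ((-2 * ψ : ℝ) : ℂ)) := by
    unfold expEven; congr 1; push_cast; ring
  rw [this, Complex.norm_exp_I_mul_ofReal_sub_one, norm_mul]
  rw [show (-2 * ψ / 2) = -ψ by ring, sin_neg]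
  simp

theorem abs_sin_mul_norm_geom_le (M : ℕ) (ψ : ℝ) :
    |sin ψ| * ‖∑ d ∈ range M, expEven (-1) ψ ^ d‖ ≤ 1 := by
  have h := mul_geom_sum (expEven (-1) ψ) M
  have h2 := congrArg norm h
  rw [norm_mul, norm_one_sub_expEven] at h2
  have h3 : ‖expEven (-1) ψ ^ M - 1‖ ≤ 2 := by
    refine (norm_sub_le _ _).trans ?_
    rw [norm_pow, norm_expEven]
    norm_num
  linarith

theorem trigPoly_packet {ℓ M : ℕ} (a : Fin (ℓ + 1)) (h : a.val + M ≤ ℓ + 1) (φ₀ φ : ℝ) :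
    trigPoly (packet M a φ₀) φ = ((1 / √M : ℝ) : ℂ) *
      (expEven (-(a.val : ℤ)) (φ - φ₀) * ∑ d ∈ range M, expEven (-1) (φ - φ₀) ^ d) := by
  unfold trigPoly packet
  rw [← Equiv.sum_comp (Equiv.addLeft a)]
  have h1 : ∀ d : Fin (ℓ + 1),
      ((if (Equiv.addLeft a d - a).val < M then 1 / √M else 0 : ℝ) : ℂ)
        * expEven (((Equiv.addLeft a d : Fin (ℓ + 1)) : ℕ) : ℤ) φ₀
        * expEven (-(((Equiv.addLeft a d : Fin (ℓ + 1)) : ℕ) : ℤ)) φ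
      = if d.val < M then ((1 / √M : ℝ) : ℂ) * (expEven (-(a.val : ℤ)) (φ - φ₀)
          * expEven (-1) (φ - φ₀) ^ d.val) else 0 := by
    intro d
    rw [Equiv.coe_addLeft, add_sub_cancel_left]
    split_ifs with hd
    · rw [mul_assoc, expEven_mul_neg, Fin.val_add_eq_of_add_lt (by omega)]
      push_cast
      rw [neg_add, expEven_add, expEven_neg_natCast d.val]
    · simp
  rw [sum_congr rfl fun d _ => h1 d, Fin.sum_univ_eq_sum_range
    (fun d => if d < M then ((1 / √M : ℝ) : ℂ) * (expEven (-(a.val : ℤ)) (φ - φ₀)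
          * expEven (-1) (φ - φ₀) ^ d) else 0), ← sum_filter, mul_sum, mul_sum]
  refine sum_congr ?_ fun _ _ => rfl
  ext d
  simp only [mem_filter, mem_range]
  omega

theorem abs_sin_mul_norm_trigPoly_packet_le {ℓ M : ℕ} (a : Fin (ℓ + 1)) (h : a.val + M ≤ ℓ + 1)
    (φ₀ φ : ℝ) : |sin (φ - φ₀)| * ‖trigPoly (packet M a φ₀) φ‖ ≤ 1 / √M := by
  rw [trigPoly_packet a h, norm_mul, norm_mul, norm_expEven, one_mul, Complex.norm_real,
    Real.norm_of_nonneg (by positivity)]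
  have := abs_sin_mul_norm_geom_le M (φ - φ₀)
  calc _ = 1 / √M * (|sin (φ - φ₀)| * ‖∑ d ∈ range M, expEven (-1) (φ - φ₀) ^ d‖) := by ring
    _ ≤ 1 / √M * 1 := by gcongr
    _ = _ := mul_one _

/-- Wave packets in the bulk are approximate eigenvectors of the Toeplitz matrix. -/
theorem norm_evenToeplitz_packet_le {s : ℝ → ℝ} (hs : Continuous s) {C : ℝ} (hC : 0 ≤ C)
    (hLip : ∀ φ φ₀, |s φ - s φ₀| ≤ C * |sin (φ - φ₀)|) {ℓ M : ℕ} (a : Fin (ℓ + 1))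
    (h : a.val + M ≤ ℓ + 1) (φ₀ : ℝ) :
    ‖WithLp.toLp 2 (evenToeplitz s (ℓ + 1) *ᵥ packet M a φ₀ - (s φ₀ : ℂ) • packet M a φ₀)‖
      ≤ C * (1 / √M) := by
  refine norm_evenToeplitz_mulVec_sub_le_of_bound hs _ (by positivity) fun φ => ?_
  have := abs_sin_mul_norm_trigPoly_packet_le a h φ₀ φ
  calc |s φ - s φ₀| * ‖trigPoly (packet M a φ₀) φ‖
      ≤ (C * |sin (φ - φ₀)|) * ‖trigPoly (packet M a φ₀) φ‖ := by gcongr; exact hLip _ _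
    _ = C * (|sin (φ - φ₀)| * ‖trigPoly (packet M a φ₀) φ‖) := by ring
    _ ≤ _ := by gcongr

theorem norm_toLp_mul_le {ι : Type*} [Fintype ι] {d : ι → ℂ} {v : ι → ℂ} {B : ℝ} (hB : 0 ≤ B)
    (h : ∀ j, v j ≠ 0 → ‖d j‖ ≤ B) :
    ‖WithLp.toLp 2 (fun j => d j * v j)‖ ≤ B * ‖WithLp.toLp 2 v‖ := by
  refine abs_le_of_sq_le_sq' ?_ (by positivity) |>.2
  rw [mul_pow, EuclideanSpace.norm_sq_eq, EuclideanSpace.norm_sq_eq, mul_sum]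
  refine sum_le_sum fun j _ => ?_
  simp only [norm_mul, mul_pow]
  by_cases hv : v j = 0
  · simp [hv]
  · gcongr
    exact h j hv

/-- Approximate eigenvectors of `T` localized where `d` is nearly equal to `α` are approximate
eigenvectors of `D T D`, `D = diag d`. -/
theorem norm_diag_mul_diag_sub_le {ι : Type*} [Fintype ι] (T : Matrix ι ι ℂ) (d : ι → ℝ)
    {α s K B δ η : ℝ} (hα : 0 ≤ α) (hs : |s| ≤ K)
    (hB : ∀ j, |d j| ≤ B) (hB0 : 0 ≤ B) (hδ0 : 0 ≤ δ)
    (hT : ∀ v : ι → ℂ, ‖WithLp.toLp 2 (T *ᵥ v)‖ ≤ K * ‖WithLp.toLp 2 v‖)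
    {u : ι → ℂ} (hu : ‖WithLp.toLp 2 u‖ = 1) (hδ : ∀ j, u j ≠ 0 → |d j - α| ≤ δ)
    (hη : ‖WithLp.toLp 2 (T *ᵥ u - (s : ℂ) • u)‖ ≤ η) :
    ‖WithLp.toLp 2 ((Matrix.of fun j k => (d j : ℂ) * d k * T j k) *ᵥ u
      - ((α ^ 2 * s : ℝ) : ℂ) • u)‖ ≤ B * (K * δ) + α * (B * η) + α * K * δ := by
  have hK : 0 ≤ K := (abs_nonneg _).trans hs
  set w : ι → ℂ := fun j => ((d j - α : ℝ) : ℂ) * u j with hw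
  have hwn : ‖WithLp.toLp 2 w‖ ≤ δ := by
    have := norm_toLp_mul_le (d := fun j => ((d j - α : ℝ) : ℂ)) (v := u) hδ0 (fun j hj => by
      rw [Complex.norm_real]; exact hδ j hj)
    rwa [hu, mul_one] at this
  have hdn : ∀ v : ι → ℂ, ‖WithLp.toLp 2 (fun j => (d j : ℂ) * v j)‖ ≤ B * ‖WithLp.toLp 2 v‖ :=
    fun v => norm_toLp_mul_le hB0 fun j _ => by rw [Complex.norm_real]; exact hB j
  have hdec : (Matrix.of fun j k => (d j : ℂ) * d k * T j k) *ᵥ u - ((α ^ 2 * s : ℝ) : ℂ) • u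
      = (fun j => (d j : ℂ) * (T *ᵥ w) j)
        + (α : ℂ) • (fun j => (d j : ℂ) * (T *ᵥ u - (s : ℂ) • u) j)
        + ((α * s : ℝ) : ℂ) • w := by
    ext j
    have h1 : ((Matrix.of fun j k => (d j : ℂ) * d k * T j k) *ᵥ u) j
        = (d j : ℂ) * (T *ᵥ w) j + α * (d j * (T *ᵥ u) j) := by
      simp only [Matrix.mulVec, dotProduct, Matrix.of_apply, mul_sum, hw]
      rw [← sum_add_distrib]
      refine sum_congr rfl fun k _ => ?_
      push_cast
      ring
    simp only [Pi.sub_apply, Pi.add_apply, Pi.smul_apply, smul_eq_mul, h1, hw]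
    push_cast
    ring
  rw [hdec, WithLp.toLp_add, WithLp.toLp_add, WithLp.toLp_smul, WithLp.toLp_smul]
  refine (norm_add₃_le).trans ?_
  rw [norm_smul, norm_smul, Complex.norm_real, Complex.norm_real, Real.norm_eq_abs,
    Real.norm_eq_abs, abs_mul, abs_of_nonneg hα]
  have i1 := (hdn (T *ᵥ w)).trans (mul_le_mul_of_nonneg_left ((hT w).trans
    (mul_le_mul_of_nonneg_left hwn hK)) hB0)
  have i2 := (hdn (T *ᵥ u - (s : ℂ) • u)).trans (mul_le_mul_of_nonneg_left hη hB0)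
  gcongr

theorem exists_lipschitz_sin {s : ℝ → ℝ} (hs : ContDiff ℝ 1 s) (hper : Function.Periodic s π) :
    ∃ C, 0 ≤ C ∧ ∀ φ φ₀, |s φ - s φ₀| ≤ C * |sin (φ - φ₀)| := by
  have hpi := pi_pos
  have hd : Continuous (deriv s) := hs.continuous_deriv le_rfl
  have hdp : Function.Periodic (deriv s) π := by
    intro x
    rw [← deriv_comp_add_const]
    congr 1
    ext y
    exact hper y
  obtain ⟨C, hC⟩ := (hdp.isBounded_of_continuous hpi.ne' hd).exists_norm_le
  have hC' : ∀ x, ‖deriv s x‖ ≤ C := fun x => hC _ ⟨x, rfl⟩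
  have hC0 : 0 ≤ C := (norm_nonneg _).trans (hC' 0)
  refine ⟨C * (π / 2), by positivity, fun φ φ₀ => ?_⟩
  set k : ℤ := round ((φ - φ₀) / π) with hk
  have hk2 : |φ - φ₀ - k * π| ≤ π / 2 := by
    have := abs_sub_round ((φ - φ₀) / π)
    have e : φ - φ₀ - k * π = ((φ - φ₀) / π - k) * π := by field_simp
    rw [e, abs_mul, abs_of_pos hpi]
    nlinarith
  have h1 : s φ = s (φ - k * π) := (hper.sub_int_mul_eq k).symm
  have h2 : |s (φ - k * π) - s φ₀| ≤ C * |φ - k * π - φ₀| :=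
    Convex.norm_image_sub_le_of_norm_deriv_le (s := Set.univ)
      (fun x _ => (hs.differentiable one_ne_zero).differentiableAt) (fun x _ => hC' x)
      convex_univ (Set.mem_univ _) (Set.mem_univ _)
  have h3 := mul_abs_le_abs_sin hk2
  have h4 : |sin (φ - φ₀ - k * π)| = |sin (φ - φ₀)| := by
    rw [sin_sub_int_mul_pi, abs_mul]
    simp
  rw [h4] at h3
  rw [h1]
  refine h2.trans ?_
  rw [show φ - k * π - φ₀ = φ - φ₀ - k * π by ring]
  calc C * |φ - φ₀ - k * π| = C * (π / 2) * (2 / π * |φ - φ₀ - k * π|) := by field_simp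
    _ ≤ _ := by gcongr

/-- The even part `(σ(φ) + σ(φ + π)) / 2`. -/
noncomputable def evenPart (σ : ℝ → ℝ) (φ : ℝ) : ℝ := (σ φ + σ (φ + π)) / 2

theorem evenPart_periodic {σ : ℝ → ℝ} (hper : Function.Periodic σ (2 * π)) :
    Function.Periodic (evenPart σ) π := by
  intro x
  unfold evenPart
  rw [show x + π + π = x + 2 * π by ring, hper, add_comm]

theorem contDiff_evenPart {σ : ℝ → ℝ} (hσ : ContDiff ℝ 1 σ) : ContDiff ℝ 1 (evenPart σ) := by
  unfold evenPart; fun_prop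

theorem Vmat_eq {σ : ℝ → ℝ} (hσ : Continuous σ) (hper : Function.Periodic σ (2 * π)) (ℓ : ℕ) :
    Vmat σ ℓ = Matrix.of fun j k : Fin (ℓ + 1) =>
      (Acoef ℓ (2 * (j : ℤ) - ℓ) : ℂ) * Acoef ℓ (2 * (k : ℤ) - ℓ)
        * evenToeplitz (evenPart σ) (ℓ + 1) j k := by
  ext j k
  have key : ∫ φ in (-π)..π, (evenPart σ φ : ℂ) * expEven ((j : ℤ) - (k : ℤ)) φ
      = ∫ φ in (-π)..π, (σ φ : ℂ) * expEven ((j : ℤ) - (k : ℤ)) φ := by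
    set F : ℝ → ℂ := fun φ => (σ φ : ℂ) * expEven ((j : ℤ) - (k : ℤ)) φ with hF
    have hFc : Continuous F := by fun_prop
    have hFp : Function.Periodic F (2 * π) := by
      intro x
      simp only [hF]
      rw [hper, show x + 2 * π = x + π + π by ring, expEven_add_pi, expEven_add_pi]
    have h1 : ∫ φ in (-π)..π, F (φ + π) = ∫ φ in (-π)..π, F φ := by
      rw [intervalIntegral.integral_comp_add_right]
      have := hFp.intervalIntegral_add_eq (-π + π) (-π)
      rw [show -π + π + 2 * π = π + π by ring, show -π + 2 * π = π by ring] at this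
      exact this
    have h2 : ∀ φ, (evenPart σ φ : ℂ) * expEven ((j : ℤ) - (k : ℤ)) φ = (F φ + F (φ + π)) / 2 := by
      intro φ
      simp only [hF, evenPart, expEven_add_pi]
      push_cast
      ring
    simp_rw [h2]
    rw [intervalIntegral.integral_div, intervalIntegral.integral_add
      (Continuous.intervalIntegrable (by fun_prop) _ _)
      (Continuous.intervalIntegrable (by fun_prop) _ _), h1]
    ring
  rw [Matrix.of_apply, evenToeplitz, key]
  unfold Vmat expEven
  push_cast
  ring

/-- The average of `f` against the spectral measure of a wave packet. -/
noncomputable def packetAvg {ℓ : ℕ} {H : Matrix (Fin (ℓ + 1)) (Fin (ℓ + 1)) ℂ} (hH : H.IsHermitian)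
    (f : ℝ → ℝ) (M : ℕ) (a : Fin (ℓ + 1)) (φ : ℝ) : ℝ :=
  ∑ k, ‖inner ℂ (hH.eigenvectorBasis k) (WithLp.toLp 2 (packet M a φ))‖ ^ 2
    * f (hH.eigenvalues k)

theorem inner_packet {ℓ M : ℕ} (v : EuclideanSpace ℂ (Fin (ℓ + 1))) (a : Fin (ℓ + 1)) (φ : ℝ) :
    inner ℂ v (WithLp.toLp 2 (packet M a φ))
      = ∑ j, (((if (j - a).val < M then 1 / √M else 0 : ℝ) : ℂ) * (starRingEnd ℂ) (v j))
          * expEven j φ := by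
  rw [PiLp.inner_apply]
  refine sum_congr rfl fun j _ => ?_
  simp only [packet, RCLike.inner_apply]
  ring

theorem continuous_packetAvg {ℓ : ℕ} {H : Matrix (Fin (ℓ + 1)) (Fin (ℓ + 1)) ℂ}
    (hH : H.IsHermitian) (f : ℝ → ℝ) (M : ℕ) (a : Fin (ℓ + 1)) :
    Continuous (packetAvg hH f M a) := by
  unfold packetAvg
  simp only [inner_packet]
  fun_prop

theorem abs_packetAvg_le {ℓ : ℕ} {H : Matrix (Fin (ℓ + 1)) (Fin (ℓ + 1)) ℂ} (hH : H.IsHermitian)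
    {f : ℝ → ℝ} {F : ℝ} (hF : ∀ x, |f x| ≤ F) {M : ℕ} (hM0 : 0 < M) (hM : M ≤ ℓ + 1)
    (a : Fin (ℓ + 1)) (φ : ℝ) : |packetAvg hH f M a φ| ≤ F := by
  have h1 := hH.eigenvectorBasis.sum_sq_norm_inner_right (WithLp.toLp 2 (packet M a φ))
  rw [norm_packet hM0 hM, one_pow] at h1
  refine (abs_sum_le_sum_abs _ _).trans ?_
  calc _ ≤ ∑ k, ‖inner ℂ (hH.eigenvectorBasis k) (WithLp.toLp 2 (packet M a φ))‖ ^ 2 * F := by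
        refine sum_le_sum fun k _ => ?_
        rw [abs_mul, abs_of_nonneg (sq_nonneg _)]
        gcongr
        exact hF _
    _ = F := by rw [← sum_mul, h1, one_mul]

/-- The wave packets resolve the identity, so they compute traces. -/
theorem sum_integral_packetAvg {ℓ : ℕ} {H : Matrix (Fin (ℓ + 1)) (Fin (ℓ + 1)) ℂ}
    (hH : H.IsHermitian) (f : ℝ → ℝ) {M : ℕ} (hM0 : 0 < M) (hM : M ≤ ℓ + 1) :
    ∑ a, 1 / (2 * π) * ∫ φ in (-π)..π, packetAvg hH f M a φ = ∑ k, f (hH.eigenvalues k) := by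
  have hpi := pi_pos
  set b := hH.eigenvectorBasis with hb
  have h1 : ∀ a, 1 / (2 * π) * ∫ φ in (-π)..π, packetAvg hH f M a φ
      = ∑ k, ∑ j, (if (j - a).val < M then 1 / √M else 0 : ℝ) ^ 2 * ‖b k j‖ ^ 2
        * f (hH.eigenvalues k) := by
    intro a
    unfold packetAvg
    simp only [inner_packet]
    rw [intervalIntegral.integral_finsetSum
      (fun j _ => (Continuous.intervalIntegrable (by fun_prop) _ _)), mul_sum]
    refine sum_congr rfl fun k _ => ?_
    rw [intervalIntegral.integral_mul_const, integral_norm_sq_sum_expEven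
      (m := fun j : Fin (ℓ + 1) => (j : ℤ)) (fun i j h => by simpa [Fin.ext_iff] using h),
      ← sum_mul]
    have : ∀ j, ‖((if (j - a).val < M then 1 / √M else 0 : ℝ) : ℂ)
        * (starRingEnd ℂ) (hH.eigenvectorBasis k j)‖ ^ 2
        = (if (j - a).val < M then 1 / √M else 0 : ℝ) ^ 2 * ‖b k j‖ ^ 2 := by
      intro j
      rw [norm_mul, mul_pow, Complex.norm_real, Real.norm_eq_abs, sq_abs, RCLike.norm_conj]
    simp_rw [this]
    field_simp
  simp_rw [h1]
  rw [sum_comm]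
  refine sum_congr rfl fun k _ => ?_
  rw [sum_comm]
  have h2 : ∀ j, ∑ a, (if (j - a).val < M then 1 / √M else 0 : ℝ) ^ 2 * ‖b k j‖ ^ 2
      * f (hH.eigenvalues k) = ‖b k j‖ ^ 2 * f (hH.eigenvalues k) := by
    intro j
    rw [← sum_mul, ← sum_mul, sum_shift_window hM0 hM, one_mul]
  simp_rw [h2]
  rw [← sum_mul, ← EuclideanSpace.norm_sq_eq, b.norm_eq_one, one_pow, one_mul]

/-- Semiclassical approximation of the packet averages of `V_ℓ(σ)` in the bulk. -/
theorem abs_packetAvg_Vmat_sub_le {σ : ℝ → ℝ} (hσ : Continuous σ)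
    (hper : Function.Periodic σ (2 * π)) {ℓ : ℕ} (hH : (Vmat σ ℓ).IsHermitian)
    {f : ℝ → ℝ} {L K C δ : ℝ} (hL0 : 0 ≤ L) (hL : ∀ x y, |f x - f y| ≤ L * |x - y|)
    (hK : ∀ φ, |evenPart σ φ| ≤ K) (hC : 0 ≤ C)
    (hLip : ∀ φ φ₀, |evenPart σ φ - evenPart σ φ₀| ≤ C * |sin (φ - φ₀)|)
    {M : ℕ} (hM0 : 0 < M) (hδ : 0 < δ) (a : Fin (ℓ + 1))
    (ha : δ * (ℓ + 1) ≤ (a.val : ℝ)) (hb : δ * (ℓ + 1) + M + a.val ≤ ℓ) (φ : ℝ)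
    {α : ℝ} (hα : α = Acoef ℓ (2 * (a.val : ℤ) - ℓ)) (hα0 : 0 < α) :
    |packetAvg hH f M a φ - f (α ^ 2 * evenPart σ φ)| ≤
      L * (√(2 * √((ℓ : ℝ) + 1)) * (K * (M / (δ ^ 2 * (ℓ + 1)) / α))
        + α * (√(2 * √((ℓ : ℝ) + 1)) * (C * (1 / √M))) + α * K * (M / (δ ^ 2 * (ℓ + 1)) / α)) := by
  have hn0 : (0 : ℝ) < (ℓ : ℝ) + 1 := by positivity
  have haM : a.val + M ≤ ℓ := by
    have : (a.val : ℝ) + M ≤ ℓ := by nlinarith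
    exact_mod_cast this
  have hs : Continuous (evenPart σ) := by unfold evenPart; fun_prop
  refine (abs_sum_eigenvalues_sub_le hH hL0 hL (norm_packet hM0 (by omega) a φ) _).trans ?_
  refine mul_le_mul_of_nonneg_left ?_ hL0
  rw [Vmat_eq hσ hper]
  refine norm_diag_mul_diag_sub_le (evenToeplitz (evenPart σ) (ℓ + 1))
    (fun j : Fin (ℓ + 1) => Acoef ℓ (2 * (j.val : ℤ) - ℓ)) hα0.le (hK φ) ?_ (by positivity)
    (by positivity) (norm_evenToeplitz_mulVec_le hs hK) (norm_packet hM0 (by omega) a φ) ?_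
    (norm_evenToeplitz_packet_le hs hC hLip a (by omega) φ)
  · intro j
    exact Real.abs_le_sqrt (Acoef_sq_le (by omega))
  · intro j hj
    have hw : (j - a).val < M := by
      by_contra h
      exact hj (by simp [packet, h])
    obtain ⟨d, hd⟩ : ∃ d, (j - a).val = d := ⟨_, rfl⟩
    have hja : j.val = a.val + d := by
      have : (a + (j - a)).val = a.val + (j - a).val := Fin.val_add_eq_of_add_lt (by omega)
      rwa [add_sub_cancel, hd] at this
    rw [hd] at hw
    have hdM : (d : ℝ) ≤ M := by exact_mod_cast hw.le
    have h1 := abs_Acoef_sq_sub_le hδ (ℓ := ℓ) (a := a.val) (d := d) (M := M) (by omega) ha (by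
      rw [Nat.cast_sub (by omega)]
      push_cast
      linarith) hdM
    rw [← hja, ← hα] at h1
    have hA := Acoef_nonneg ℓ (2 * (j.val : ℤ) - ℓ)
    rw [le_div_iff₀ hα0]
    refine le_trans ?_ h1
    rw [sq_sub_sq, abs_mul, mul_comm]
    gcongr
    exact (le_add_of_nonneg_left hA).trans (le_abs_self _)

theorem exists_window_length : ∃ M : ℕ → ℕ, (∀ ℓ, 0 < M ℓ ∧ M ℓ ≤ ℓ + 1) ∧
    Tendsto (fun ℓ : ℕ => √(2 * √((ℓ : ℝ) + 1)) * (M ℓ / ((ℓ : ℝ) + 1))) atTop (nhds 0) ∧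
    Tendsto (fun ℓ : ℕ => (M ℓ / ((ℓ : ℝ) + 1))) atTop (nhds 0) ∧
    Tendsto (fun ℓ : ℕ => √(2 * √((ℓ : ℝ) + 1)) * (1 / √(M ℓ))) atTop (nhds 0) := by
  set y : ℕ → ℝ := fun ℓ => ((ℓ : ℝ) + 1) ^ (1 / 16 : ℝ) with hy
  have hn1 : ∀ ℓ : ℕ, (1 : ℝ) ≤ (ℓ : ℝ) + 1 := fun ℓ => by simp
  have hy1 : ∀ ℓ, 1 ≤ y ℓ := fun ℓ => Real.one_le_rpow (hn1 ℓ) (by norm_num)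
  have hy16 : ∀ ℓ : ℕ, (ℓ : ℝ) + 1 = y ℓ ^ 16 := by
    intro ℓ
    rw [hy, ← Real.rpow_natCast, ← Real.rpow_mul (by positivity)]
    norm_num
  have hyt : Tendsto y atTop atTop :=
    (tendsto_rpow_atTop (by norm_num)).comp
      (tendsto_atTop_add_const_right _ _ tendsto_natCast_atTop_atTop)
  have hB : ∀ ℓ : ℕ, √(2 * √((ℓ : ℝ) + 1)) = √2 * y ℓ ^ 4 := by
    intro ℓ
    have := hy1 ℓ
    rw [hy16, show y ℓ ^ 16 = (y ℓ ^ 8) ^ 2 by ring, Real.sqrt_sq (by positivity),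
      Real.sqrt_mul (by norm_num), show y ℓ ^ 8 = (y ℓ ^ 4) ^ 2 by ring,
      Real.sqrt_sq (by positivity)]
  have hyinv : Tendsto (fun ℓ => (y ℓ)⁻¹) atTop (nhds 0) := tendsto_inv_atTop_zero.comp hyt
  have hlow : ∀ ℓ, y ℓ ^ 10 ≤ (⌈y ℓ ^ 10⌉₊ : ℝ) := fun ℓ => Nat.le_ceil _
  have hup : ∀ ℓ, (⌈y ℓ ^ 10⌉₊ : ℝ) ≤ 2 * y ℓ ^ 10 := by
    intro ℓ
    have h1 := (Nat.ceil_lt_add_one (by have := hy1 ℓ; positivity : 0 ≤ y ℓ ^ 10)).le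
    have h2 : 1 ≤ y ℓ ^ 10 := one_le_pow₀ (hy1 ℓ)
    linarith
  have hbound : ∀ ℓ : ℕ, (⌈y ℓ ^ 10⌉₊ : ℝ) / ((ℓ : ℝ) + 1) ≤ 2 * (y ℓ)⁻¹ ^ 6 := by
    intro ℓ
    have := hy1 ℓ
    rw [hy16, div_le_iff₀ (by positivity)]
    refine (hup ℓ).trans (le_of_eq ?_)
    field_simp
  refine ⟨fun ℓ => ⌈y ℓ ^ 10⌉₊, fun ℓ => ⟨?_, ?_⟩, ?_, ?_, ?_⟩
  · have := hy1 ℓ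
    exact Nat.ceil_pos.2 (by positivity)
  · rw [Nat.ceil_le]
    push_cast
    rw [hy16]
    exact pow_le_pow_right₀ (hy1 ℓ) (by norm_num)
  · refine squeeze_zero (g := fun ℓ => 2 * √2 * (y ℓ)⁻¹ ^ 2) (fun ℓ => by positivity)
      (fun ℓ => ?_) ?_
    · have := hy1 ℓ
      rw [hB]
      refine (mul_le_mul_of_nonneg_left (hbound ℓ) (by positivity)).trans (le_of_eq ?_)
      field_simp
    · simpa using (hyinv.pow 2).const_mul (2 * √2)
  · refine squeeze_zero (fun ℓ => by positivity) hbound ?_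
    simpa using (hyinv.pow 6).const_mul 2
  · refine squeeze_zero (g := fun ℓ => √2 * (y ℓ)⁻¹) (fun ℓ => by positivity) (fun ℓ => ?_) ?_
    · have := hy1 ℓ
      rw [hB]
      have h5 : y ℓ ^ 5 ≤ √(⌈y ℓ ^ 10⌉₊ : ℝ) := by
        refine Real.le_sqrt_of_sq_le ?_
        rw [← pow_mul]
        exact hlow ℓ
      calc √2 * y ℓ ^ 4 * (1 / √(⌈y ℓ ^ 10⌉₊ : ℝ)) ≤ √2 * y ℓ ^ 4 * (1 / y ℓ ^ 5) := by gcongr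
        _ = _ := by field_simp
    · simpa using hyinv.const_mul √2

theorem sum_fin_eq_integral_floor {ℓ : ℕ} (G : Fin (ℓ + 1) → ℝ) :
    1 / ((ℓ : ℝ) + 1) * ∑ a, G a
      = ∫ x in (0 : ℝ)..1, G (Fin.ofNat (ℓ + 1) ⌊((ℓ : ℝ) + 1) * x⌋₊) := by
  set g : ℕ → ℝ := fun a => G (Fin.ofNat (ℓ + 1) a) with hg
  have h1 : ∑ a, G a = ∑ a ∈ range (ℓ + 1), g a := by
    rw [← Fin.sum_univ_eq_sum_range]
    simp [hg]
  have hstep : ∀ a : ℕ, Set.EqOn (fun y : ℝ => g ⌊y⌋₊) (fun _ => g a)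
      (Set.Ico (a : ℝ) ((a + 1 : ℕ) : ℝ)) := by
    intro a y hy
    have : ⌊y⌋₊ = a := (Nat.floor_eq_iff (a.cast_nonneg.trans hy.1)).2 ⟨hy.1, by simpa using hy.2⟩
    simp only [this]
  have hae : ∀ a : ℕ, ∀ᵐ y : ℝ, y ∈ Set.uIoc (a : ℝ) ((a + 1 : ℕ) : ℝ) → g ⌊y⌋₊ = g a := by
    intro a
    have : ∀ᵐ y : ℝ, y ≠ ((a + 1 : ℕ) : ℝ) := by
      simp [MeasureTheory.ae_iff]
    filter_upwards [this] with y hy hmem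
    rw [Set.uIoc_of_le (by simp)] at hmem
    exact hstep a ⟨hmem.1.le, lt_of_le_of_ne hmem.2 hy⟩
  have h2 : ∀ a : ℕ, ∫ y in (a : ℝ)..((a + 1 : ℕ) : ℝ), g ⌊y⌋₊ = g a := by
    intro a
    rw [intervalIntegral.integral_congr_ae (hae a)]
    simp
  have h3 : ∀ a : ℕ, IntervalIntegrable (fun y : ℝ => g ⌊y⌋₊) MeasureTheory.volume
      (a : ℝ) ((a + 1 : ℕ) : ℝ) := by
    intro a
    refine (intervalIntegrable_const (c := g a)).congr_ae ?_
    rw [Filter.EventuallyEq, MeasureTheory.ae_restrict_iff' measurableSet_uIoc]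
    filter_upwards [hae a] with y hy hmem using (hy hmem).symm
  have h4 := intervalIntegral.sum_integral_adjacent_intervals (n := ℓ + 1)
    (a := fun k : ℕ => (k : ℝ)) (f := fun y : ℝ => g ⌊y⌋₊) (fun k _ => h3 k)
  have h5 : ∑ a ∈ range (ℓ + 1), g a = ∫ y in (0 : ℝ)..((ℓ : ℝ) + 1), g ⌊y⌋₊ := by
    rw [← sum_congr rfl fun a _ => h2 a, h4]
    simp
  rw [h1, h5, intervalIntegral.integral_comp_mul_left (fun y => g ⌊y⌋₊) (by positivity)]
  simp

/-- The mean of `f (t s(φ))` over the circle. -/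
noncomputable def angularMean (f s : ℝ → ℝ) (t : ℝ) : ℝ :=
  1 / (2 * π) * ∫ φ in (-π)..π, f (t * s φ)

theorem continuous_angularMean {f s : ℝ → ℝ} (hf : Continuous f) (hs : Continuous s) :
    Continuous (angularMean f s) := by
  unfold angularMean
  refine continuous_const.mul
    (intervalIntegral.continuous_parametric_intervalIntegral_of_continuous' ?_ _ _)
  fun_prop

theorem integral_angularMean_eq {f s : ℝ → ℝ} (hf : Continuous f) (hs : Continuous s) {F : ℝ}
    (hF : ∀ x, |f x| ≤ F) :
    ∫ x in (0 : ℝ)..1, angularMean f s (2 / (π * √(x * (1 - x))))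
      = 1 / (4 * π) * ∫ φ in (-π)..π, ∫ ξ in (-1 : ℝ)..1, f (4 * s φ / (π * √(1 - ξ ^ 2))) := by
  have hpi := pi_pos
  have hswap : ∫ φ in (-π)..π, ∫ ξ in (-1 : ℝ)..1, f (4 * s φ / (π * √(1 - ξ ^ 2)))
      = ∫ ξ in (-1 : ℝ)..1, ∫ φ in (-π)..π, f (4 * s φ / (π * √(1 - ξ ^ 2))) := by
    simp only [intervalIntegral.integral_of_le (by linarith : -π ≤ π),
      intervalIntegral.integral_of_le (by norm_num : (-1 : ℝ) ≤ 1)]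
    refine MeasureTheory.integral_integral_swap
      (MeasureTheory.Integrable.of_bound (C := F) ?_ (Filter.Eventually.of_forall fun p => hF _))
    refine Measurable.aestronglyMeasurable ?_
    unfold Function.uncurry
    refine hf.measurable.comp ?_
    have := hs.measurable
    fun_prop
  have hmean : ∀ ξ : ℝ, ∫ φ in (-π)..π, f (4 * s φ / (π * √(1 - ξ ^ 2)))
      = 2 * π * angularMean f s (4 / (π * √(1 - ξ ^ 2))) := by
    intro ξ
    unfold angularMean
    rw [← mul_assoc, mul_one_div_cancel (by positivity), one_mul]
    congr 1
    ext φ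
    congr 1
    ring
  have hsub := intervalIntegral.integral_comp_mul_sub (a := 0) (b := 1)
    (fun ξ => angularMean f s (4 / (π * √(1 - ξ ^ 2)))) (c := 2) two_ne_zero 1
  have hpt : ∀ x : ℝ, 4 / (π * √(1 - (2 * x - 1) ^ 2)) = 2 / (π * √(x * (1 - x))) := by
    intro x
    rw [show 1 - (2 * x - 1) ^ 2 = 2 ^ 2 * (x * (1 - x)) by ring, Real.sqrt_mul (by norm_num),
      Real.sqrt_sq (by norm_num), show π * (2 * √(x * (1 - x))) = 2 * (π * √(x * (1 - x))) by ring,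
      ← div_div]
    norm_num
  simp only [hpt] at hsub
  rw [hsub, hswap]
  simp only [hmean]
  rw [intervalIntegral.integral_const_mul]
  norm_num
  field_simp
  norm_num

/-- Pointwise convergence of the averaged packet densities. -/
theorem tendsto_mean_packetAvg {σ : ℝ → ℝ} (hσ : ContDiff ℝ 1 σ)
    (hper : Function.Periodic σ (2 * π)) (hH : ∀ ℓ : ℕ, (Vmat σ ℓ).IsHermitian)
    {f : ℝ → ℝ} (hfc : Continuous f) {L : ℝ} (hL0 : 0 ≤ L)
    (hL : ∀ x y, |f x - f y| ≤ L * |x - y|) {M : ℕ → ℕ} (hM : ∀ ℓ, 0 < M ℓ ∧ M ℓ ≤ ℓ + 1)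
    (hM1 : Tendsto (fun ℓ : ℕ => √(2 * √((ℓ : ℝ) + 1)) * (M ℓ / ((ℓ : ℝ) + 1))) atTop (nhds 0))
    (hM2 : Tendsto (fun ℓ : ℕ => (M ℓ / ((ℓ : ℝ) + 1))) atTop (nhds 0))
    (hM3 : Tendsto (fun ℓ : ℕ => √(2 * √((ℓ : ℝ) + 1)) * (1 / √(M ℓ))) atTop (nhds 0))
    {x : ℝ} (hx0 : 0 < x) (hx1 : x < 1) :
    Tendsto (fun ℓ : ℕ => 1 / (2 * π) * ∫ φ in (-π)..π,
        packetAvg (hH ℓ) f (M ℓ) (Fin.ofNat (ℓ + 1) ⌊((ℓ : ℝ) + 1) * x⌋₊) φ) atTop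
      (nhds (angularMean f (evenPart σ) (2 / (π * √(x * (1 - x)))))) := by
  have hpi := pi_pos
  have hsc : Continuous (evenPart σ) := (contDiff_evenPart hσ).continuous
  obtain ⟨C, hC, hLip⟩ := exists_lipschitz_sin (contDiff_evenPart hσ) (evenPart_periodic hper)
  obtain ⟨K, hK⟩ := ((evenPart_periodic hper).isBounded_of_continuous hpi.ne' hsc).exists_norm_le
  have hK : ∀ φ, |evenPart σ φ| ≤ K := fun φ => hK _ ⟨φ, rfl⟩
  set a : ℕ → ℕ := fun ℓ => ⌊((ℓ : ℝ) + 1) * x⌋₊ with ha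
  set α : ℕ → ℝ := fun ℓ => Acoef ℓ (2 * (a ℓ : ℤ) - ℓ) with hαdef
  have hα2 : Tendsto (fun ℓ => α ℓ ^ 2) atTop (nhds (2 / (π * √(x * (1 - x))))) :=
    tendsto_Acoef_sq hx0 hx1
  set t := 2 / (π * √(x * (1 - x))) with ht
  have hxx : 0 < x * (1 - x) := mul_pos hx0 (by linarith)
  have ht0 : 0 < t := by positivity
  have hα : Tendsto α atTop (nhds √t) := by
    refine hα2.sqrt.congr fun ℓ => Real.sqrt_sq (Acoef_nonneg _ _)
  have hst : 0 < √t := Real.sqrt_pos.2 ht0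
  obtain ⟨δ, hδ, hδx, hδx1⟩ : ∃ δ : ℝ, 0 < δ ∧ 2 * δ ≤ x ∧ 2 * δ ≤ 1 - x := by
    refine ⟨min x (1 - x) / 2, half_pos (lt_min hx0 (by linarith)), ?_, ?_⟩
    · linarith [min_le_left x (1 - x)]
    · linarith [min_le_right x (1 - x)]
  set err : ℕ → ℝ := fun ℓ =>
    L * (√(2 * √((ℓ : ℝ) + 1)) * (K * (M ℓ / (δ ^ 2 * (ℓ + 1)) / α ℓ))
        + α ℓ * (√(2 * √((ℓ : ℝ) + 1)) * (C * (1 / √(M ℓ))))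
        + α ℓ * K * (M ℓ / (δ ^ 2 * (ℓ + 1)) / α ℓ)) with herr
  have herr0 : Tendsto err atTop (nhds 0) := by
    have e1 := (hM1.mul (hα.inv₀ hst.ne')).const_mul (K / δ ^ 2)
    have e2 := (hα.mul hM3).const_mul C
    have e3 := (hα.mul (hM2.mul (hα.inv₀ hst.ne'))).const_mul (K / δ ^ 2)
    have := ((e1.add e2).add e3).const_mul L
    simp only [zero_mul, mul_zero, add_zero] at this
    refine this.congr fun ℓ => ?_
    simp only [herr]
    congr 1
    field_simp
  have hmain : Tendsto (fun ℓ => angularMean f (evenPart σ) (α ℓ ^ 2)) atTop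
      (nhds (angularMean f (evenPart σ) t)) :=
    ((continuous_angularMean hfc hsc).tendsto t).comp hα2
  refine tendsto_of_tendsto_of_dist hmain (squeeze_zero' (g := err)
    (Filter.Eventually.of_forall fun _ => dist_nonneg) ?_ herr0)
  have hinv : Tendsto (fun ℓ : ℕ => 1 / ((ℓ : ℝ) + 1)) atTop (nhds 0) :=
    tendsto_one_div_add_atTop_nhds_zero_nat
  have hsmall := hM2.add hinv
  rw [add_zero] at hsmall
  filter_upwards [hsmall.eventually_lt_const hδ, hα.eventually_const_lt hst] with ℓ h1 h2
  have hn : (0 : ℝ) < (ℓ : ℝ) + 1 := by positivity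
  rw [← add_div, div_lt_iff₀ hn] at h1
  have hMp : (0 : ℝ) < M ℓ := by exact_mod_cast (hM ℓ).1
  have ha1 : ((ℓ : ℝ) + 1) * x < a ℓ + 1 := Nat.lt_floor_add_one _
  have ha2 : (a ℓ : ℝ) ≤ ((ℓ : ℝ) + 1) * x := Nat.floor_le (by positivity)
  have hb1 : δ * ((ℓ : ℝ) + 1) ≤ a ℓ := by nlinarith
  have hb2 : δ * ((ℓ : ℝ) + 1) + M ℓ + a ℓ ≤ ℓ := by nlinarith
  have haℓ : a ℓ ≤ ℓ := by
    have : (a ℓ : ℝ) ≤ ℓ := by nlinarith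
    exact_mod_cast this
  have hval : (Fin.ofNat (ℓ + 1) (a ℓ)).val = a ℓ := Nat.mod_eq_of_lt (by omega)
  have hpoint : ∀ φ, |packetAvg (hH ℓ) f (M ℓ) (Fin.ofNat (ℓ + 1) (a ℓ)) φ
      - f (α ℓ ^ 2 * evenPart σ φ)| ≤ err ℓ := fun φ =>
    abs_packetAvg_Vmat_sub_le hσ.continuous hper (hH ℓ) hL0 hL hK hC hLip (hM ℓ).1 hδ _
      (by rw [hval]; exact hb1) (by rw [hval]; exact hb2) φ (by rw [hval]) h2
  rw [dist_comm, Real.dist_eq]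
  unfold angularMean
  rw [← mul_sub, ← intervalIntegral.integral_sub
    ((continuous_packetAvg _ _ _ _).intervalIntegrable _ _)
    (Continuous.intervalIntegrable (by fun_prop) _ _), abs_mul, abs_of_pos (by positivity)]
  have h3 := intervalIntegral.norm_integral_le_of_norm_le_const (a := -π) (b := π)
    (fun φ _ => (Real.norm_eq_abs _).trans_le (hpoint φ))
  rw [Real.norm_eq_abs, sub_neg_eq_add, abs_of_pos (by linarith : 0 < π + π)] at h3
  calc _ ≤ 1 / (2 * π) * (err ℓ * (π + π)) := by gcongr
    _ = err ℓ := by field_simp; ring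

theorem eigenvalue_cluster_density
    (σ : ℝ → ℝ) (hσ : ContDiff ℝ 1 σ) (hper : Function.Periodic σ (2*Real.pi))
    (hH : ∀ ℓ : ℕ, (Vmat σ ℓ).IsHermitian)
    (f : ℝ → ℝ) (hf : ContDiff ℝ (⊤ : ℕ∞) f) (hsupp : HasCompactSupport f) (hf0 : f 0 = 0) :
    Tendsto
      (fun ℓ : ℕ => (1/((ℓ:ℝ)+1)) * ∑ k, f ((hH ℓ).eigenvalues k))
      atTop
      (nhds ((1/(4*Real.pi)) *
        ∫ φ in (-Real.pi)..Real.pi, ∫ ξ in (-1:ℝ)..(1:ℝ),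
          f (4 * ((σ φ + σ (φ + Real.pi))/2) / (Real.pi * Real.sqrt (1 - ξ^2))))) := by
  have hpi := pi_pos
  have hfc : Continuous f := hf.continuous
  obtain ⟨F, hF⟩ := hsupp.exists_bound_of_continuous hfc
  obtain ⟨L, hL⟩ := hf.lipschitzWith_of_hasCompactSupport hsupp (by simp)
  have hL' : ∀ x y, |f x - f y| ≤ L * |x - y| := fun x y => by
    simpa [Real.dist_eq] using hL.dist_le_mul x y
  have hsc : Continuous (evenPart σ) := (contDiff_evenPart hσ).continuous
  obtain ⟨M, hM, hM1, hM2, hM3⟩ := exists_window_length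
  have hlim := integral_angularMean_eq hfc hsc hF
  unfold evenPart at hlim
  rw [← hlim]
  have hrew : ∀ ℓ : ℕ, (1 / ((ℓ : ℝ) + 1)) * ∑ k, f ((hH ℓ).eigenvalues k)
      = ∫ x in (0 : ℝ)..1, 1 / (2 * π) * ∫ φ in (-π)..π,
        packetAvg (hH ℓ) f (M ℓ) (Fin.ofNat (ℓ + 1) ⌊((ℓ : ℝ) + 1) * x⌋₊) φ := fun ℓ => by
    rw [← sum_integral_packetAvg (hH ℓ) f (hM ℓ).1 (hM ℓ).2, sum_fin_eq_integral_floor]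
  simp_rw [hrew]
  refine intervalIntegral.tendsto_integral_filter_of_dominated_convergence (fun _ => F)
    (Filter.Eventually.of_forall fun ℓ => ?_) (Filter.Eventually.of_forall fun ℓ => ?_)
    intervalIntegrable_const ?_
  · refine Measurable.aestronglyMeasurable ?_
    have h1 : Measurable fun m : ℕ => 1 / (2 * π) * ∫ φ in (-π)..π,
        packetAvg (hH ℓ) f (M ℓ) (Fin.ofNat (ℓ + 1) m) φ := measurable_from_top
    exact h1.comp (Nat.measurable_floor.comp (measurable_const_mul ((ℓ : ℝ) + 1)))
  · refine Filter.Eventually.of_forall fun x _ => ?_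
    rw [norm_mul, Real.norm_of_nonneg (by positivity)]
    have h3 := intervalIntegral.norm_integral_le_of_norm_le_const (a := -π) (b := π)
      (fun φ _ => (Real.norm_eq_abs _).trans_le (abs_packetAvg_le (hH ℓ) hF (hM ℓ).1 (hM ℓ).2
        (Fin.ofNat (ℓ + 1) ⌊((ℓ : ℝ) + 1) * x⌋₊) φ))
    rw [sub_neg_eq_add, abs_of_pos (by linarith : 0 < π + π)] at h3
    calc _ ≤ 1 / (2 * π) * (F * (π + π)) := by gcongr
      _ = F := by field_simp; ring
  · have hne : ∀ᵐ x : ℝ, x ≠ 1 := by simp [MeasureTheory.ae_iff]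
    filter_upwards [hne] with x hx hmem
    rw [Set.uIoc_of_le zero_le_one] at hmem
    exact tendsto_mean_packetAvg hσ hper hH hfc L.2 hL' hM hM1 hM2 hM3 hmem.1
      (lt_of_le_of_ne hmem.2 hx)
end

section
/- Let ω ∈ C^∞(ℝ) be nonnegative with compact support contained in (−1,1), let σ : ℝ → ℝ be C¹ and 2π-periodic, and let f ∈ C^∞(ℝ) be compactly supported with f(0) = 0. Then lim_{ℓ→∞} (1/(ℓ+1)) · Σ_{k=1}^{ℓ−1} f(λ_k(W_ℓ(ω,σ))) = (1/(4π)) · ∫_{−π}^{π} ∫_{−1}^{1} f( ω(ξ)²·σ_even(φ) ) dξ dφ, where λ_1(W_ℓ(ω,σ)) ≤ … ≤ λ_{ℓ−1}(W_ℓ(ω,σ)) are the eigenvalues of W_ℓ(ω,σ) listed in non-decreasing order with multiplicity. -/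
open Real Filter Finset

/-- The (ℓ−1)×(ℓ−1) Hermitian matrix W_ℓ(ω,σ) with entries
W_ℓ(ω,σ)_{j,k} = ω(m_j/ℓ)·ω(m_k/ℓ)·(1/(2π))·∫_{−π}^{π} σ(φ)·e^{i(m_j−m_k)φ} dφ,
where m_j = 2j − ℓ + 2. -/
noncomputable def Wmat (ω σ : ℝ → ℝ) (ℓ : ℕ) : Matrix (Fin (ℓ-1)) (Fin (ℓ-1)) ℂ :=
  fun j k =>
    ((ω (((2*(j:ℤ) - (ℓ:ℤ) + 2 : ℤ) : ℝ) / (ℓ:ℝ)) *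
      ω (((2*(k:ℤ) - (ℓ:ℤ) + 2 : ℤ) : ℝ) / (ℓ:ℝ)) * (1/(2*Real.pi)) : ℝ) : ℂ) *
      ∫ φ in (-Real.pi)..Real.pi,
        (σ φ : ℂ) * Complex.exp (Complex.I * (((2*((j:ℤ) - (k:ℤ))) : ℤ) : ℂ) * (φ : ℂ))

section Toeplitz

open scoped Matrix.Norms.L2Operator
open MeasureTheory AddCircle

variable {T : ℝ} [hT : Fact (0 < T)]

lemma integrable_haarAddCircle (f : C(AddCircle T, ℂ)) : Integrable f haarAddCircle :=
  f.continuous.integrable_of_hasCompactSupport (HasCompactSupport.of_compactSpace f)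

/-- The Toeplitz matrix of size `n` with symbol `f`. -/
noncomputable def toeplitz (n : ℕ) : C(AddCircle T, ℂ) →ₗ[ℂ] Matrix (Fin n) (Fin n) ℂ where
  toFun f := Matrix.of fun j k => fourierCoeff f ((k : ℤ) - j)
  map_add' f g := by
    ext j k
    exact congrFun (fourierCoeff.add (integrable_haarAddCircle f) (integrable_haarAddCircle g)) _
  map_smul' c f := by
    ext j k
    exact fourierCoeff.const_smul f c _

lemma toeplitz_apply (n : ℕ) (f : C(AddCircle T, ℂ)) (j k : Fin n) :
    toeplitz n f j k = fourierCoeff f ((k : ℤ) - j) := rfl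

lemma toeplitz_fourier_apply (n : ℕ) (r : ℤ) (j k : Fin n) :
    toeplitz n (fourier r : C(AddCircle T, ℂ)) j k = if (k : ℤ) = j + r then 1 else 0 := by
  rw [toeplitz_apply, fourierCoeff_fourier, Pi.single_apply]
  exact if_congr (by omega) rfl rfl

lemma norm_toLp_mul_le_s10 (f g : C(AddCircle T, ℂ)) :
    ‖ContinuousMap.toLp 2 (haarAddCircle (T := T)) ℂ (f * g)‖ ≤
      ‖f‖ * ‖ContinuousMap.toLp 2 (haarAddCircle (T := T)) ℂ g‖ := by
  refine Lp.norm_le_mul_norm_of_ae_le_mul ?_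
  filter_upwards [ContinuousMap.coeFn_toLp (p := 2) (𝕜 := ℂ) haarAddCircle (f * g),
    ContinuousMap.coeFn_toLp (p := 2) (𝕜 := ℂ) haarAddCircle g] with x h1 h2
  rw [h1, h2]
  simpa using mul_le_mul_of_nonneg_right (f.norm_coe_le_norm x) (norm_nonneg _)

lemma norm_toeplitz_le (n : ℕ) (f : C(AddCircle T, ℂ)) : ‖toeplitz n f‖ ≤ ‖f‖ := by
  rw [Matrix.cstar_norm_def]
  refine ContinuousLinearMap.opNorm_le_bound _ (norm_nonneg _) fun y => ?_
  have horth : Orthonormal ℂ (fun j : Fin n => @fourierLp T hT 2 _ (-(j : ℤ))) :=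
    orthonormal_fourier.comp (fun j : Fin n => -(j : ℤ)) fun i j h => by
      simpa [Fin.ext_iff] using h
  set Y : C(AddCircle T, ℂ) := ∑ k : Fin n, y k • fourier (-(k : ℤ)) with hY
  have hYn : ‖ContinuousMap.toLp 2 (haarAddCircle (T := T)) ℂ Y‖ = ‖y‖ := by
    have h1 : ContinuousMap.toLp 2 (haarAddCircle (T := T)) ℂ Y =
        ∑ k : Fin n, y k • @fourierLp T hT 2 _ (-(k : ℤ)) := by
      simp [hY, fourierLp]
    rw [h1, EuclideanSpace.norm_eq, ← Real.sqrt_sq (norm_nonneg (∑ k : Fin n, _))]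
    congr 1
    have := horth.inner_sum (fun k => y k) (fun k => y k) Finset.univ
    rw [inner_self_eq_norm_sq_to_K] at this
    have h2 := congrArg Complex.re this
    simp only [Complex.conj_mul'] at h2
    exact_mod_cast h2
  have hentry : ∀ j : Fin n, (Matrix.toEuclideanCLM (n := Fin n) (𝕜 := ℂ) (toeplitz n f)) y j =
      inner ℂ (@fourierLp T hT 2 _ (-(j : ℤ)))
        (ContinuousMap.toLp 2 (haarAddCircle (T := T)) ℂ (f * Y)) := by
    intro j
    rw [Matrix.ofLp_toEuclideanCLM]
    simp only [hY, Finset.mul_sum, map_sum, inner_sum, Matrix.mulVec, dotProduct, mul_smul_comm,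
      map_smul, inner_smul_right]
    refine Finset.sum_congr rfl fun k _ => ?_
    rw [mul_comm, fourierLp, ContinuousMap.inner_toLp, toeplitz_apply, fourierCoeff]
    congr 1
    refine integral_congr_ae (Eventually.of_forall fun t => ?_)
    simp only [ContinuousMap.mul_apply, smul_eq_mul]
    rw [← fourier_neg, neg_neg, show (-((k : ℤ) - j)) = j + -k by ring, fourier_add]
    ring
  have hbessel := horth.sum_inner_products_le
    (ContinuousMap.toLp 2 (haarAddCircle (T := T)) ℂ (f * Y)) (s := Finset.univ)
  calc _ ≤ ‖ContinuousMap.toLp 2 (haarAddCircle (T := T)) ℂ (f * Y)‖ := by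
        rw [EuclideanSpace.norm_eq]
        refine Real.sqrt_le_iff.2 ⟨norm_nonneg _, ?_⟩
        simpa only [hentry] using hbessel
    _ ≤ ‖f‖ * ‖y‖ := (norm_toLp_mul_le_s10 f Y).trans_eq (by rw [hYn])

/-- A uniformly bounded family of linear maps that tends to zero on all Fourier monomials tends to
zero on all continuous functions. -/
lemma tendsto_norm_zero_of_fourier {V : ℕ → Type*} [∀ l, SeminormedAddCommGroup (V l)]
    [∀ l, Module ℂ (V l)] [∀ l, NormSMulClass ℂ (V l)]
    (E : ∀ l, C(AddCircle T, ℂ) →ₗ[ℂ] V l) (K : ℝ)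
    (hK : ∀ l f, ‖E l f‖ ≤ K * ‖f‖)
    (h : ∀ r : ℤ, Tendsto (fun l => ‖E l (fourier r)‖) atTop (nhds 0))
    (f : C(AddCircle T, ℂ)) : Tendsto (fun l => ‖E l f‖) atTop (nhds 0) := by
  have hspan : ∀ g ∈ Submodule.span ℂ (Set.range (@fourier T)),
      Tendsto (fun l => ‖E l g‖) atTop (nhds 0) := by
    intro g hg
    induction hg using Submodule.span_induction with
    | mem x hx => obtain ⟨r, rfl⟩ := hx; exact h r
    | zero => simp
    | add x y _ _ hx hy =>
      refine squeeze_zero (fun _ => norm_nonneg _) (fun l => ?_) (by simpa using hx.add hy)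
      rw [map_add]; exact norm_add_le _ _
    | smul a x _ hx =>
      simpa [norm_smul] using hx.const_mul ‖a‖
  have hf : f ∈ (Submodule.span ℂ (Set.range (@fourier T))).topologicalClosure := by
    rw [span_fourier_closure_eq_top]; trivial
  rw [← SetLike.mem_coe, Submodule.topologicalClosure_coe, Metric.mem_closure_iff] at hf
  rw [Metric.tendsto_atTop]
  intro ε hε
  obtain ⟨g, hg, hfg⟩ := hf (ε / 2 / (|K| + 1)) (by positivity)
  obtain ⟨N, hN⟩ := Metric.tendsto_atTop.1 (hspan g hg) (ε / 2) (by positivity)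
  refine ⟨N, fun l hl => ?_⟩
  have h1 := hN l hl
  simp only [dist_zero_right, norm_norm] at h1 ⊢
  have h2 : ‖E l (f - g)‖ ≤ ε / 2 := by
    rw [dist_eq_norm, lt_div_iff₀ (by positivity)] at hfg
    refine (hK l _).trans ?_
    nlinarith [le_abs_self K, norm_nonneg (f - g)]
  calc ‖E l f‖ = ‖E l (f - g) + E l g‖ := by rw [← map_add, sub_add_cancel]
    _ ≤ _ := norm_add_le _ _
    _ < ε := by linarith

end Toeplitz

section NormedRing

lemma norm_pow_mul_sub_mul_pow_le {R : Type*} [NormedRing R] {a c : R} {M : ℝ}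
    (hc : ‖c‖ ≤ M) (h1 : ‖(1:R)‖ ≤ 1) (p : ℕ) :
    ‖c ^ p * a - a * c ^ p‖ ≤ p * M ^ (p - 1) * ‖a * c - c * a‖ := by
  have hM : 0 ≤ M := (norm_nonneg c).trans hc
  induction p with
  | zero => simp
  | succ p ih =>
    have hcp : ‖c ^ p‖ ≤ M ^ p := by
      rcases Nat.eq_zero_or_pos p with rfl | hp
      · simpa using h1
      · exact (norm_pow_le' c hp).trans (by gcongr)
    have hMp : p * M ^ (p - 1) * M = p * M ^ p := by
      rcases Nat.eq_zero_or_pos p with rfl | hp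
      · simp
      · rw [mul_assoc, ← pow_succ, Nat.sub_add_cancel hp]
    have : c ^ (p + 1) * a - a * c ^ (p + 1) =
        (c ^ p * a - a * c ^ p) * c - c ^ p * (a * c - c * a) := by
      rw [pow_succ]; noncomm_ring
    rw [this]
    calc _ ≤ ‖(c ^ p * a - a * c ^ p) * c‖ + ‖c ^ p * (a * c - c * a)‖ := norm_sub_le _ _
      _ ≤ ‖c ^ p * a - a * c ^ p‖ * ‖c‖ + ‖c ^ p‖ * ‖a * c - c * a‖ :=
        add_le_add (norm_mul_le _ _) (norm_mul_le _ _)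
      _ ≤ (p * M ^ (p - 1) * ‖a * c - c * a‖) * M + M ^ p * ‖a * c - c * a‖ := by gcongr
      _ = (p * M ^ (p - 1) * M) * ‖a * c - c * a‖ + M ^ p * ‖a * c - c * a‖ := by ring
      _ = _ := by rw [hMp, Nat.add_sub_cancel]; push_cast; ring

/-- Powers of `d * c * d` agree with `d ^ (2 * p) * c ^ p` up to the size of the commutator. -/
lemma exists_norm_conj_pow_sub_le (M : ℝ) (p : ℕ) : ∃ K : ℝ, ∀ (R : Type) [NormedRing R] (d c : R),
    ‖(1:R)‖ ≤ 1 → ‖d‖ ≤ M → ‖c‖ ≤ M →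
    ‖(d * c * d) ^ p - d ^ (2 * p) * c ^ p‖ ≤ K * ‖d * c - c * d‖ := by
  induction p with
  | zero => exact ⟨0, fun R _ d c _ _ _ => by simp⟩
  | succ p ih =>
    obtain ⟨K, hK⟩ := ih
    refine ⟨K * (M * M * M) + M ^ (2 * p) * (p * M ^ (p - 1) * (2 * M)) * M
        + M ^ (2 * p) * M ^ p * M, fun R _ d c h1 hd hc => ?_⟩
    have hM : 0 ≤ M := (norm_nonneg c).trans hc
    have hpow : ∀ (x : R) (q : ℕ), ‖x‖ ≤ M → ‖x ^ q‖ ≤ M ^ q := by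
      intro x q hx
      rcases Nat.eq_zero_or_pos q with rfl | hq
      · simpa using h1
      · exact (norm_pow_le' x hq).trans (by gcongr)
    have hcomm : ‖(d * d) * c - c * (d * d)‖ ≤ 2 * M * ‖d * c - c * d‖ := by
      have : (d * d) * c - c * (d * d) = d * (d * c - c * d) + (d * c - c * d) * d := by
        noncomm_ring
      rw [this]
      calc _ ≤ ‖d‖ * ‖d * c - c * d‖ + ‖d * c - c * d‖ * ‖d‖ :=
            (norm_add_le _ _).trans (add_le_add (norm_mul_le _ _) (norm_mul_le _ _))
        _ ≤ M * ‖d * c - c * d‖ + ‖d * c - c * d‖ * M := by gcongr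
        _ = _ := by ring
    have hpc : ‖c ^ p * (d * d) - (d * d) * c ^ p‖ ≤
        p * M ^ (p - 1) * (2 * M) * ‖d * c - c * d‖ :=
      (norm_pow_mul_sub_mul_pow_le hc h1 p).trans (by rw [mul_assoc _ (2 * M)]; gcongr)
    have hdcd : ‖d * c * d‖ ≤ M * M * M :=
      (norm_mul₃_le).trans (by gcongr)
    have key : (d * c * d) ^ (p + 1) - d ^ (2 * (p + 1)) * c ^ (p + 1) =
        ((d * c * d) ^ p - d ^ (2 * p) * c ^ p) * (d * c * d)
        + d ^ (2 * p) * (c ^ p * (d * d) - (d * d) * c ^ p) * c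
        - d ^ (2 * p) * (c ^ p * d * (d * c - c * d)) := by
      rw [show 2 * (p + 1) = 2 * p + 1 + 1 by ring, pow_succ, pow_succ _ (2 * p + 1),
        pow_succ _ (2 * p), pow_succ c]
      noncomm_ring
    rw [key]
    calc _ ≤ ‖(d * c * d) ^ p - d ^ (2 * p) * c ^ p‖ * ‖d * c * d‖
          + ‖d ^ (2 * p)‖ * ‖c ^ p * (d * d) - (d * d) * c ^ p‖ * ‖c‖
          + ‖d ^ (2 * p)‖ * (‖c ^ p‖ * ‖d‖ * ‖d * c - c * d‖) := by
          refine (norm_sub_le _ _).trans (add_le_add ((norm_add_le _ _).trans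
            (add_le_add (norm_mul_le _ _) norm_mul₃_le)) ?_)
          exact (norm_mul_le _ _).trans (by gcongr; exact norm_mul₃_le)
      _ ≤ (K * ‖d * c - c * d‖) * (M * M * M)
          + M ^ (2 * p) * (p * M ^ (p - 1) * (2 * M) * ‖d * c - c * d‖) * M
          + M ^ (2 * p) * (M ^ p * M * ‖d * c - c * d‖) := by
          have hP := hK R d c h1 hd hc
          have h2 := hpow d (2 * p) hd
          have h3 := hpow c p hc
          have : 0 ≤ K * ‖d * c - c * d‖ := (norm_nonneg _).trans hP
          gcongr
      _ = _ := by ring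

end NormedRing


section Window

open scoped Matrix.Norms.L2Operator
open AddCircle

/-- The diagonal matrix with entries `ω (m_j / ℓ)`, `m_j = 2 j - ℓ + 2`. -/
noncomputable def window (ω : ℝ → ℝ) (ℓ : ℕ) : Matrix (Fin (ℓ - 1)) (Fin (ℓ - 1)) ℂ :=
  Matrix.diagonal fun j => (ω (((2 * (j : ℤ) - (ℓ : ℤ) + 2 : ℤ) : ℝ) / (ℓ : ℝ)) : ℂ)

lemma norm_window_le {ω : ℝ → ℝ} {M : ℝ} (hM0 : 0 ≤ M) (hM : ∀ x, |ω x| ≤ M) (ℓ : ℕ) :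
    ‖window ω ℓ‖ ≤ M := by
  rw [window, Matrix.l2_opNorm_diagonal, pi_norm_le_iff_of_nonneg hM0]
  intro j
  simpa using hM _

lemma norm_one_matrix_le (n : ℕ) : ‖(1 : Matrix (Fin n) (Fin n) ℂ)‖ ≤ 1 := by
  rw [← Matrix.diagonal_one, Matrix.l2_opNorm_diagonal, pi_norm_le_iff_of_nonneg zero_le_one]
  simp

lemma norm_apply_le (n : ℕ) (A : Matrix (Fin n) (Fin n) ℂ) (i j : Fin n) : ‖A i j‖ ≤ ‖A‖ := by
  have h := Matrix.l2_opNorm_mulVec A (EuclideanSpace.single j (1 : ℂ))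
  have h2 := (PiLp.norm_apply_le
    (WithLp.toLp 2 (A.mulVec (EuclideanSpace.single j (1 : ℂ)).ofLp) :
      EuclideanSpace ℂ (Fin n)) i).trans h
  simpa using h2

lemma norm_trace_le (n : ℕ) (A : Matrix (Fin n) (Fin n) ℂ) : ‖A.trace‖ ≤ n * ‖A‖ := by
  refine (norm_sum_le _ _).trans ?_
  refine (Finset.sum_le_sum fun i _ => norm_apply_le n A i i).trans ?_
  simp

lemma sum_eigenvalues_pow {n : ℕ} {A : Matrix (Fin n) (Fin n) ℂ} (hA : A.IsHermitian) (p : ℕ) :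
    ((∑ k, hA.eigenvalues k ^ p : ℝ) : ℂ) = (A ^ p).trace := by
  conv_rhs => rw [hA.spectral_theorem, ← map_pow, Unitary.conjStarAlgAut_apply,
    Matrix.trace_mul_cycle, Unitary.coe_star_mul_self, one_mul, Matrix.diagonal_pow,
    Matrix.trace_diagonal]
  simp

lemma abs_eigenvalues_le {n : ℕ} {A : Matrix (Fin n) (Fin n) ℂ} (hA : A.IsHermitian) (k : Fin n) :
    |hA.eigenvalues k| ≤ ‖A‖ := by
  have h := Matrix.l2_opNorm_mulVec A (hA.eigenvectorBasis k)
  rw [hA.mulVec_eigenvectorBasis] at h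
  simpa [norm_smul] using h

/-- Near the ends of the index range the window vanishes. -/
lemma eventually_add_mem_range {ω : ℝ → ℝ} (hωsupp : HasCompactSupport ω)
    (hωsub : tsupport ω ⊆ Set.Ioo (-1 : ℝ) 1) (r : ℤ) : ∀ᶠ ℓ : ℕ in atTop, ∀ j : ℤ,
      ω (((2 * j - (ℓ : ℤ) + 2 : ℤ) : ℝ) / (ℓ : ℝ)) ≠ 0 → 0 ≤ j + r ∧ j + r < (ℓ - 1 : ℕ) := by
  obtain ⟨δ, hδ, hδω⟩ : ∃ δ > 0, ∀ x, ω x ≠ 0 → |x| ≤ 1 - δ := by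
    rcases (tsupport ω).eq_empty_or_nonempty with h | h
    · refine ⟨1, one_pos, fun x hx => ?_⟩
      exact absurd (subset_tsupport ω hx) (by simp [h])
    · obtain ⟨x, hx, hmax⟩ := hωsupp.isCompact.exists_isMaxOn h continuous_abs.continuousOn
      refine ⟨1 - |x|, sub_pos.2 (abs_lt.2 (hωsub hx)), fun y hy => ?_⟩
      simpa using hmax (subset_tsupport ω hy)
  have hlim : Tendsto (fun ℓ : ℕ => δ * (ℓ : ℝ)) atTop atTop :=
    tendsto_natCast_atTop_atTop.const_mul_atTop hδ
  filter_upwards [hlim.eventually_ge_atTop (2 * |(r : ℝ)| + 2), eventually_ge_atTop 1]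
    with ℓ hℓ hℓ1 j hj
  have hpos : (0 : ℝ) < ℓ := by exact_mod_cast hℓ1
  have h := hδω _ hj
  rw [abs_div, abs_of_pos hpos, div_le_iff₀ hpos, abs_le] at h
  push_cast at h
  have hr := abs_le.1 (le_refl |(r : ℝ)|)
  constructor
  · have : (0 : ℝ) ≤ j + r := by nlinarith
    exact_mod_cast this
  · have : (j + r : ℝ) < ℓ - 1 := by nlinarith
    have : j + r < (ℓ : ℤ) - 1 := by exact_mod_cast this
    omega

variable {T : ℝ} [hT : Fact (0 < T)]

lemma eventually_window_mul_toeplitz_mul {ω : ℝ → ℝ} (hωsupp : HasCompactSupport ω)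
    (hωsub : tsupport ω ⊆ Set.Ioo (-1 : ℝ) 1) (r s : ℤ) : ∀ᶠ ℓ : ℕ in atTop,
      window ω ℓ * (toeplitz (ℓ - 1) (fourier r : C(AddCircle T, ℂ)) * toeplitz (ℓ - 1) (fourier s : C(AddCircle T, ℂ))
        - toeplitz (ℓ - 1) (fourier r * fourier s : C(AddCircle T, ℂ))) = 0 := by
  filter_upwards [eventually_add_mem_range hωsupp hωsub r] with ℓ hℓ
  have hmul : (fourier r * fourier s : C(AddCircle T, ℂ)) = fourier (r + s) := by
    ext x; simp
  ext j k
  rw [window, Matrix.diagonal_mul, Matrix.sub_apply, Matrix.mul_apply, hmul]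
  simp only [toeplitz_fourier_apply, Matrix.zero_apply]
  by_cases hj : ω (((2 * (j : ℤ) - (ℓ : ℤ) + 2 : ℤ) : ℝ) / (ℓ : ℝ)) = 0
  · rw [hj]; simp
  obtain ⟨h0, h1⟩ := hℓ _ hj
  lift (j : ℤ) + r to ℕ using h0 with m hm
  have hm1 : m < ℓ - 1 := by exact_mod_cast h1
  rw [Finset.sum_eq_single (⟨m, hm1⟩ : Fin (ℓ - 1))]
  · rw [← add_assoc, ← hm]; simp
  · intro b _ hb
    have : (b : ℤ) ≠ m := fun h => hb (Fin.ext (by exact_mod_cast h))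
    simp [this]
  · simp

lemma tendsto_commutator_fourier {ω : ℝ → ℝ} (hω : Continuous ω) (hωsupp : HasCompactSupport ω)
    (r : ℤ) : Tendsto (fun ℓ : ℕ => ‖window ω ℓ * toeplitz (ℓ - 1) (fourier r : C(AddCircle T, ℂ))
      - toeplitz (ℓ - 1) (fourier r : C(AddCircle T, ℂ)) * window ω ℓ‖) atTop (nhds 0) := by
  have huc := hωsupp.uniformContinuous_of_continuous hω
  rw [Metric.tendsto_atTop]
  intro ε hε
  obtain ⟨δ, hδ, hω'⟩ := Metric.uniformContinuous_iff.1 huc (ε / 2) (by positivity)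
  have hlim : Tendsto (fun ℓ : ℕ => δ * (ℓ : ℝ)) atTop atTop :=
    tendsto_natCast_atTop_atTop.const_mul_atTop hδ
  obtain ⟨N, hN⟩ := eventually_atTop.1 (hlim.eventually_gt_atTop (2 * |(r : ℝ)|))
  refine ⟨max N 1, fun ℓ hℓ => ?_⟩
  have hpos : (0 : ℝ) < ℓ := by exact_mod_cast (le_max_right _ _).trans hℓ
  set x : ℤ → ℝ := fun j => ((2 * j - (ℓ : ℤ) + 2 : ℤ) : ℝ) / (ℓ : ℝ) with hx
  have hclose : ∀ j : ℤ, |ω (x j) - ω (x (j + r))| ≤ ε / 2 := by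
    intro j
    refine (hω' ?_).le
    rw [dist_eq_norm, hx, ← sub_div, norm_div, Real.norm_of_nonneg hpos.le, div_lt_iff₀ hpos]
    convert hN ℓ ((le_max_left _ _).trans hℓ) using 1
    push_cast
    rw [Real.norm_eq_abs, ← abs_of_pos (two_pos (α := ℝ)), ← abs_mul, ← abs_neg]
    simp only [abs_two]
    congr 1
    ring
  have heq : window ω ℓ * toeplitz (ℓ - 1) (fourier r : C(AddCircle T, ℂ))
      - toeplitz (ℓ - 1) (fourier r : C(AddCircle T, ℂ)) * window ω ℓ
      = Matrix.diagonal (fun j : Fin (ℓ - 1) => ((ω (x j) - ω (x (j + r)) : ℝ) : ℂ))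
        * toeplitz (ℓ - 1) (fourier r : C(AddCircle T, ℂ)) := by
    ext j k
    rw [window, Matrix.sub_apply, Matrix.diagonal_mul, Matrix.mul_diagonal, Matrix.diagonal_mul,
      toeplitz_fourier_apply]
    split_ifs with h
    · rw [h]; simp [hx]
    · simp
  rw [heq, dist_zero_right, norm_norm]
  calc _ ≤ ε / 2 * 1 := by
        refine (norm_mul_le _ _).trans (mul_le_mul ?_ ((norm_toeplitz_le _ _).trans
          (fourier_norm r).le) (norm_nonneg _) (by positivity))
        rw [Matrix.l2_opNorm_diagonal, pi_norm_le_iff_of_nonneg (by positivity)]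
        intro j
        rw [Complex.norm_real]
        exact hclose j
    _ < ε := by linarith

end Window

section Moments

open scoped Matrix.Norms.L2Operator
open AddCircle MeasureTheory

variable {T : ℝ} [hT : Fact (0 < T)]

lemma toeplitz_one (n : ℕ) : toeplitz n (1 : C(AddCircle T, ℂ)) = 1 := by
  have : (1 : C(AddCircle T, ℂ)) = fourier 0 := by ext x; simp
  ext j k
  rw [this, toeplitz_fourier_apply, Matrix.one_apply]
  exact if_congr (by rw [Fin.ext_iff]; omega) rfl rfl

lemma tendsto_commutator {ω : ℝ → ℝ} (hω : Continuous ω) (hωsupp : HasCompactSupport ω)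
    (f : C(AddCircle T, ℂ)) : Tendsto (fun ℓ : ℕ => ‖window ω ℓ * toeplitz (ℓ - 1) f
      - toeplitz (ℓ - 1) f * window ω ℓ‖) atTop (nhds 0) := by
  obtain ⟨M, hM⟩ := hωsupp.exists_bound_of_continuous hω
  have hM0 : 0 ≤ M := (norm_nonneg _).trans (hM 0)
  refine tendsto_norm_zero_of_fourier (fun ℓ =>
    LinearMap.mulLeft ℂ (window ω ℓ) ∘ₗ toeplitz (ℓ - 1) -
      LinearMap.mulRight ℂ (window ω ℓ) ∘ₗ toeplitz (ℓ - 1)) (2 * M) (fun ℓ g => ?_)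
    (fun r => tendsto_commutator_fourier hω hωsupp r) f
  have hD := norm_window_le hM0 hM ℓ
  have hg := norm_toeplitz_le (ℓ - 1) g
  calc _ ≤ ‖window ω ℓ‖ * ‖toeplitz (ℓ - 1) g‖ + ‖toeplitz (ℓ - 1) g‖ * ‖window ω ℓ‖ :=
        (norm_sub_le _ _).trans (add_le_add (norm_mul_le _ _) (norm_mul_le _ _))
    _ ≤ M * ‖g‖ + ‖g‖ * M := by gcongr
    _ = _ := by ring

lemma tendsto_window_mul_toeplitz_mul {ω : ℝ → ℝ} (hω : Continuous ω)
    (hωsupp : HasCompactSupport ω) (hωsub : tsupport ω ⊆ Set.Ioo (-1 : ℝ) 1)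
    (f g : C(AddCircle T, ℂ)) : Tendsto (fun ℓ : ℕ => ‖window ω ℓ *
      (toeplitz (ℓ - 1) f * toeplitz (ℓ - 1) g - toeplitz (ℓ - 1) (f * g))‖) atTop (nhds 0) := by
  obtain ⟨M, hM⟩ := hωsupp.exists_bound_of_continuous hω
  have hM0 : 0 ≤ M := (norm_nonneg _).trans (hM 0)
  have hbound : ∀ (ℓ : ℕ) (f g : C(AddCircle T, ℂ)), ‖window ω ℓ *
      (toeplitz (ℓ - 1) f * toeplitz (ℓ - 1) g - toeplitz (ℓ - 1) (f * g))‖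
        ≤ M * (2 * (‖f‖ * ‖g‖)) := by
    intro ℓ f g
    have hf := norm_toeplitz_le (ℓ - 1) f
    have hg := norm_toeplitz_le (ℓ - 1) g
    refine (norm_mul_le _ _).trans
      (mul_le_mul (norm_window_le hM0 hM ℓ) ?_ (norm_nonneg _) hM0)
    calc _ ≤ ‖toeplitz (ℓ - 1) f‖ * ‖toeplitz (ℓ - 1) g‖ + ‖toeplitz (ℓ - 1) (f * g)‖ :=
          (norm_sub_le _ _).trans (add_le_add (norm_mul_le _ _) le_rfl)
      _ ≤ ‖f‖ * ‖g‖ + ‖f‖ * ‖g‖ := by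
          gcongr
          exact (norm_toeplitz_le _ _).trans (norm_mul_le _ _)
      _ = _ := by ring
  have hmono : ∀ r : ℤ, Tendsto (fun ℓ : ℕ => ‖window ω ℓ *
      (toeplitz (ℓ - 1) (fourier r : C(AddCircle T, ℂ)) * toeplitz (ℓ - 1) g -
        toeplitz (ℓ - 1) ((fourier r : C(AddCircle T, ℂ)) * g))‖) atTop (nhds 0) := by
    intro r
    have h := tendsto_norm_zero_of_fourier (T := T) (fun ℓ => LinearMap.mulLeft ℂ (window ω ℓ) ∘ₗ
      (LinearMap.mulLeft ℂ (toeplitz (ℓ - 1) (fourier r : C(AddCircle T, ℂ))) ∘ₗ toeplitz (ℓ - 1) -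
        toeplitz (ℓ - 1) ∘ₗ LinearMap.mulLeft ℂ (fourier r : C(AddCircle T, ℂ))))
      (M * 2 * ‖(fourier r : C(AddCircle T, ℂ))‖)
    simp only [LinearMap.comp_apply, LinearMap.sub_apply, LinearMap.mulLeft_apply] at h
    refine h (fun ℓ g => (hbound ℓ _ g).trans_eq (by ring)) (fun s => ?_) g
    refine tendsto_const_nhds.congr' ?_
    filter_upwards [eventually_window_mul_toeplitz_mul (T := T) hωsupp hωsub r s] with ℓ hℓ
    rw [hℓ, norm_zero]
  have h := tendsto_norm_zero_of_fourier (T := T) (fun ℓ => LinearMap.mulLeft ℂ (window ω ℓ) ∘ₗ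
    (LinearMap.mulRight ℂ (toeplitz (ℓ - 1) g) ∘ₗ toeplitz (ℓ - 1) -
      toeplitz (ℓ - 1) ∘ₗ LinearMap.mulRight ℂ g)) (M * 2 * ‖g‖)
  simp only [LinearMap.comp_apply, LinearMap.sub_apply, LinearMap.mulLeft_apply,
    LinearMap.mulRight_apply] at h
  exact h (fun ℓ f => (hbound ℓ f g).trans_eq (by ring)) hmono f

lemma tendsto_window_mul_toeplitz_pow {ω : ℝ → ℝ} (hω : Continuous ω)
    (hωsupp : HasCompactSupport ω) (hωsub : tsupport ω ⊆ Set.Ioo (-1 : ℝ) 1)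
    (g : C(AddCircle T, ℂ)) (p : ℕ) : Tendsto (fun ℓ : ℕ => ‖window ω ℓ *
      (toeplitz (ℓ - 1) g ^ p - toeplitz (ℓ - 1) (g ^ p))‖) atTop (nhds 0) := by
  induction p with
  | zero => simp [toeplitz_one]
  | succ p ih =>
    have h := tendsto_window_mul_toeplitz_mul hω hωsupp hωsub (g ^ p) g
    refine squeeze_zero (fun _ => norm_nonneg _) (fun ℓ => ?_)
      (by simpa using (ih.mul_const ‖g‖).add h)
    have : window ω ℓ * (toeplitz (ℓ - 1) g ^ (p + 1) - toeplitz (ℓ - 1) (g ^ (p + 1))) =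
        window ω ℓ * (toeplitz (ℓ - 1) g ^ p - toeplitz (ℓ - 1) (g ^ p)) * toeplitz (ℓ - 1) g +
        window ω ℓ * (toeplitz (ℓ - 1) (g ^ p) * toeplitz (ℓ - 1) g
          - toeplitz (ℓ - 1) (g ^ p * g)) := by
      rw [pow_succ, pow_succ]; noncomm_ring
    rw [this]
    refine (norm_add_le _ _).trans (add_le_add ((norm_mul_le _ _).trans ?_) le_rfl)
    gcongr
    exact norm_toeplitz_le _ _

/-- Powers of a windowed Toeplitz matrix are asymptotically windowed Toeplitz matrices. -/
lemma tendsto_windowed_pow_sub {ω : ℝ → ℝ} (hω : Continuous ω)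
    (hωsupp : HasCompactSupport ω) (hωsub : tsupport ω ⊆ Set.Ioo (-1 : ℝ) 1)
    (g : C(AddCircle T, ℂ)) {p : ℕ} (hp : p ≠ 0) : Tendsto (fun ℓ : ℕ =>
      ‖(window ω ℓ * toeplitz (ℓ - 1) g * window ω ℓ) ^ p
        - window ω ℓ ^ (2 * p) * toeplitz (ℓ - 1) (g ^ p)‖) atTop (nhds 0) := by
  obtain ⟨M, hM⟩ := hωsupp.exists_bound_of_continuous hω
  have hM0 : 0 ≤ M := (norm_nonneg _).trans (hM 0)
  obtain ⟨K, hK⟩ := exists_norm_conj_pow_sub_le (max M ‖g‖) p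
  have h1 := (tendsto_commutator hω hωsupp g).const_mul K
  have h2 := (tendsto_window_mul_toeplitz_pow hω hωsupp hωsub g p).const_mul (M ^ (2 * p - 1))
  refine squeeze_zero (fun _ => norm_nonneg _) (fun ℓ => ?_) (by simpa using h1.add h2)
  have hD := norm_window_le hM0 hM ℓ
  have hpow : window ω ℓ ^ (2 * p) = window ω ℓ ^ (2 * p - 1) * window ω ℓ := by
    rw [← pow_succ, Nat.sub_add_cancel (by omega)]
  have hsplit : (window ω ℓ * toeplitz (ℓ - 1) g * window ω ℓ) ^ p
        - window ω ℓ ^ (2 * p) * toeplitz (ℓ - 1) (g ^ p) =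
      ((window ω ℓ * toeplitz (ℓ - 1) g * window ω ℓ) ^ p
        - window ω ℓ ^ (2 * p) * toeplitz (ℓ - 1) g ^ p) + window ω ℓ ^ (2 * p - 1) *
      (window ω ℓ * (toeplitz (ℓ - 1) g ^ p - toeplitz (ℓ - 1) (g ^ p))) := by
    rw [← mul_assoc, ← hpow]; noncomm_ring
  rw [hsplit]
  refine (norm_add_le _ _).trans (add_le_add ?_ ((norm_mul_le _ _).trans ?_))
  · exact hK _ _ _ (norm_one_matrix_le _) (hD.trans (le_max_left _ _))
      ((norm_toeplitz_le _ _).trans (le_max_right _ _))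
  · gcongr
    exact (norm_pow_le' _ (by omega)).trans (by gcongr)

lemma tendsto_sum_integral {F : ℝ → ℝ} (hF : Continuous F) (hFs : HasCompactSupport F)
    (hF1 : F (-1) = 0) : Tendsto (fun ℓ : ℕ => (1 / ((ℓ : ℝ) + 1)) *
      ∑ j : Fin (ℓ - 1), F (((2 * (j : ℤ) - (ℓ : ℤ) + 2 : ℤ) : ℝ) / (ℓ : ℝ))) atTop
      (nhds ((1 / 2) * ∫ x in (-1 : ℝ)..1, F x)) := by
  have huc := hFs.uniformContinuous_of_continuous hF
  set S : ℕ → ℝ := fun ℓ => ∑ j : Fin (ℓ - 1), F (((2 * (j : ℤ) - (ℓ : ℤ) + 2 : ℤ) : ℝ) / (ℓ : ℝ))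
  have hmain : Tendsto (fun ℓ : ℕ => 2 / (ℓ : ℝ) * S ℓ) atTop
      (nhds (∫ x in (-1 : ℝ)..1, F x)) := by
    rw [Metric.tendsto_atTop]
    intro ε hε
    obtain ⟨δ, hδ, hδF⟩ := Metric.uniformContinuous_iff.1 huc (ε / 4) (by positivity)
    have hlim : Tendsto (fun ℓ : ℕ => δ * (ℓ : ℝ)) atTop atTop :=
      tendsto_natCast_atTop_atTop.const_mul_atTop hδ
    obtain ⟨N, hN⟩ := eventually_atTop.1 (hlim.eventually_gt_atTop 2)
    refine ⟨max N 1, fun ℓ hℓ => ?_⟩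
    have hpos : (0 : ℝ) < ℓ := by exact_mod_cast (le_max_right _ _).trans hℓ
    have hδℓ : 2 / (ℓ : ℝ) < δ := by
      rw [div_lt_iff₀ hpos]; exact hN ℓ ((le_max_left _ _).trans hℓ)
    set a : ℕ → ℝ := fun i => -1 + 2 / (ℓ : ℝ) * i with ha
    have ha_succ : ∀ i, a (i + 1) = a i + 2 / (ℓ : ℝ) := fun i => by simp [ha]; ring
    have hS : S ℓ = ∑ i ∈ Finset.range ℓ, F (a i) := by
      obtain ⟨n, rfl⟩ : ∃ n, ℓ = n + 1 :=
        ⟨ℓ - 1, (Nat.sub_add_cancel ((le_max_right _ _).trans hℓ)).symm⟩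
      rw [Finset.sum_range_succ', ← Fin.sum_univ_eq_sum_range (fun i => F (a (i + 1)))]
      simp only [S, ha, Nat.cast_zero, mul_zero, add_zero, hF1]
      refine Finset.sum_congr rfl fun j _ => congrArg F ?_
      field_simp
      push_cast
      ring
    have hint : ∫ x in (-1 : ℝ)..1, F x = ∑ i ∈ Finset.range ℓ, ∫ x in a i..a (i + 1), F x := by
      rw [intervalIntegral.sum_integral_adjacent_intervals
        (fun k _ => hF.intervalIntegrable _ _)]
      have h0 : a 0 = -1 := by simp [ha]
      have h1 : a ℓ = 1 := by simp only [ha]; field_simp; norm_num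
      rw [h0, h1]
    have hterm : ∀ i, |2 / (ℓ : ℝ) * F (a i) - ∫ x in a i..a (i + 1), F x|
        ≤ ε / 4 * (2 / (ℓ : ℝ)) := by
      intro i
      have hc : 2 / (ℓ : ℝ) * F (a i) = ∫ x in a i..a (i + 1), F (a i) := by
        rw [intervalIntegral.integral_const, ha_succ]; simp
      rw [hc, ← intervalIntegral.integral_sub (by simp) (hF.intervalIntegrable _ _)]
      have h2 : (0 : ℝ) < 2 / (ℓ : ℝ) := by positivity
      have h3 := intervalIntegral.norm_integral_le_of_norm_le_const (a := a i) (b := a (i + 1))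
        (f := fun x => F (a i) - F x) (C := ε / 4) fun x hx => by
          rw [Set.uIoc_of_le (by rw [ha_succ]; linarith)] at hx
          rw [← dist_eq_norm]
          refine (hδF ?_).le
          rw [dist_eq_norm, Real.norm_eq_abs, abs_lt]
          have := ha_succ i
          constructor <;> linarith [hx.1, hx.2]
      rw [ha_succ, add_sub_cancel_left, abs_of_pos h2] at h3
      rw [ha_succ]
      exact h3
    rw [hS, hint, dist_eq_norm, Finset.mul_sum, ← Finset.sum_sub_distrib]
    calc _ ≤ ∑ i ∈ Finset.range ℓ, ε / 4 * (2 / (ℓ : ℝ)) :=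
          (norm_sum_le _ _).trans (Finset.sum_le_sum fun i _ => hterm i)
      _ = ε / 2 := by simp; field_simp; norm_num
      _ < ε := by linarith
  have hfrac := (tendsto_natCast_div_add_atTop (𝕜 := ℝ) 1).const_mul (1 / 2)
  have := hfrac.mul hmain
  rw [mul_one] at this
  refine this.congr' ?_
  filter_upwards [eventually_ge_atTop 1] with ℓ hℓ
  have hpos : (0 : ℝ) < ℓ := by exact_mod_cast hℓ
  field_simp
  rfl

lemma trace_window_pow_mul_toeplitz (ω : ℝ → ℝ) (g : C(AddCircle T, ℂ)) (ℓ q : ℕ) :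
    (window ω ℓ ^ q * toeplitz (ℓ - 1) g).trace =
      ((∑ j : Fin (ℓ - 1), ω (((2 * (j : ℤ) - (ℓ : ℤ) + 2 : ℤ) : ℝ) / (ℓ : ℝ)) ^ q : ℝ) : ℂ) *
        fourierCoeff g 0 := by
  rw [window, Matrix.diagonal_pow, Matrix.trace, Complex.ofReal_sum, Finset.sum_mul]
  refine Finset.sum_congr rfl fun j _ => ?_
  simp [Matrix.diagonal_mul, toeplitz_apply]

lemma tendsto_trace_windowed_pow {ω : ℝ → ℝ} (hω : Continuous ω)
    (hωsupp : HasCompactSupport ω) (hωsub : tsupport ω ⊆ Set.Ioo (-1 : ℝ) 1)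
    (g : C(AddCircle T, ℂ)) {p : ℕ} (hp : p ≠ 0) : Tendsto (fun ℓ : ℕ =>
      ((1 / ((ℓ : ℝ) + 1) : ℝ) : ℂ) *
        ((window ω ℓ * toeplitz (ℓ - 1) g * window ω ℓ) ^ p).trace) atTop
      (nhds ((((1 / 2) * ∫ x in (-1 : ℝ)..1, ω x ^ (2 * p) : ℝ) : ℂ) *
        fourierCoeff (g ^ p : C(AddCircle T, ℂ)) 0)) := by
  have hω1 : ω (-1) = 0 := by
    by_contra h
    exact lt_irrefl _ (hωsub (subset_tsupport ω h)).1
  have hsum := tendsto_sum_integral (F := fun x => ω x ^ (2 * p)) (hω.pow (2 * p))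
    (hωsupp.comp_left (g := fun x => x ^ (2 * p)) (by simp [hp])) (by simp [hω1, hp])
  have hmain := ((Complex.continuous_ofReal.tendsto _).comp hsum).mul_const
    (fourierCoeff (g ^ p : C(AddCircle T, ℂ)) 0)
  have herr : Tendsto (fun ℓ : ℕ => ((1 / ((ℓ : ℝ) + 1) : ℝ) : ℂ) *
      ((window ω ℓ * toeplitz (ℓ - 1) g * window ω ℓ) ^ p
        - window ω ℓ ^ (2 * p) * toeplitz (ℓ - 1) (g ^ p)).trace) atTop (nhds 0) := by
    refine squeeze_zero_norm (fun ℓ => ?_) (tendsto_windowed_pow_sub hω hωsupp hωsub g hp)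
    rw [norm_mul, Complex.norm_real, Real.norm_of_nonneg (by positivity)]
    refine (mul_le_mul_of_nonneg_left (norm_trace_le _ _) (by positivity)).trans ?_
    rw [← mul_assoc]
    refine mul_le_of_le_one_left (norm_nonneg _) ?_
    rw [one_div_mul_eq_div, div_le_one (by positivity)]
    have : ((ℓ - 1 : ℕ) : ℝ) ≤ ℓ := by exact_mod_cast Nat.sub_le _ _
    linarith
  have := hmain.add herr
  rw [add_zero] at this
  refine this.congr fun ℓ => ?_
  rw [Matrix.trace_sub, trace_window_pow_mul_toeplitz]
  simp only [Function.comp_apply]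
  push_cast
  ring

end Moments

section Symbol

open scoped Matrix.Norms.L2Operator
open AddCircle MeasureTheory

lemma continuous_integral_symbol {ω s h : ℝ → ℝ} (hω : Continuous ω) (hs : Continuous s)
    (hh : Continuous h) : Continuous fun φ => ∫ ξ in (-1 : ℝ)..1, h (ω ξ ^ 2 * s φ) :=
  intervalIntegral.continuous_parametric_intervalIntegral_of_continuous' (by fun_prop) _ _

lemma abs_integral_symbol_sub_le {ω s h₁ h₂ : ℝ → ℝ} (hω : Continuous ω) (hs : Continuous s)
    (hh₁ : Continuous h₁) (hh₂ : Continuous h₂) {ε : ℝ}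
    (h : ∀ ξ φ, |h₁ (ω ξ ^ 2 * s φ) - h₂ (ω ξ ^ 2 * s φ)| ≤ ε) :
    |(1 / (4 * π)) * (∫ φ in (-π)..π, ∫ ξ in (-1 : ℝ)..1, h₁ (ω ξ ^ 2 * s φ)) -
      (1 / (4 * π)) * (∫ φ in (-π)..π, ∫ ξ in (-1 : ℝ)..1, h₂ (ω ξ ^ 2 * s φ))| ≤ ε := by
  have hinner : ∀ φ, |(∫ ξ in (-1 : ℝ)..1, h₁ (ω ξ ^ 2 * s φ)) -
      ∫ ξ in (-1 : ℝ)..1, h₂ (ω ξ ^ 2 * s φ)| ≤ ε * 2 := by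
    intro φ
    rw [← intervalIntegral.integral_sub
      (Continuous.intervalIntegrable (by fun_prop) _ _)
      (Continuous.intervalIntegrable (by fun_prop) _ _)]
    have := intervalIntegral.norm_integral_le_of_norm_le_const (a := -1) (b := 1)
      (f := fun ξ => h₁ (ω ξ ^ 2 * s φ) - h₂ (ω ξ ^ 2 * s φ)) (C := ε) fun ξ _ => h ξ φ
    norm_num at this
    exact this
  rw [← mul_sub, ← intervalIntegral.integral_sub
    ((continuous_integral_symbol hω hs hh₁).intervalIntegrable _ _)
    ((continuous_integral_symbol hω hs hh₂).intervalIntegrable _ _), abs_mul,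
    abs_of_pos (by positivity)]
  have := intervalIntegral.norm_integral_le_of_norm_le_const (a := -π) (b := π)
    (f := fun φ => (∫ ξ in (-1 : ℝ)..1, h₁ (ω ξ ^ 2 * s φ)) -
      ∫ ξ in (-1 : ℝ)..1, h₂ (ω ξ ^ 2 * s φ)) (C := ε * 2) fun φ _ => hinner φ
  rw [show π - -π = 2 * π by ring, abs_of_pos (by positivity)] at this
  calc _ ≤ (1 / (4 * π)) * (ε * 2 * (2 * π)) := by gcongr; exact this
    _ = ε := by field_simp; ring

/-- A continuous `π`-periodic real function as a complex function on the circle. -/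
noncomputable def circleSymbol (s : ℝ → ℝ) (hs : Continuous s) (hper : Function.Periodic s π) :
    C(AddCircle π, ℂ) where
  toFun := Function.Periodic.lift (hper.comp (fun x : ℝ => (x : ℂ)))
  continuous_toFun := continuous_quot_lift _ (Complex.continuous_ofReal.comp hs)

lemma circleSymbol_coe {s : ℝ → ℝ} (hs : Continuous s) (hper : Function.Periodic s π) (x : ℝ) :
    circleSymbol s hs hper x = s x := rfl

lemma fourierCoeff_circleSymbol [Fact (0 < π)] {s : ℝ → ℝ} (hs : Continuous s)
    (hper : Function.Periodic s π) (n : ℤ) :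
    fourierCoeff (circleSymbol s hs hper) (-n) =
      (1 / π : ℝ) • ∫ φ in (-π)..0, (s φ : ℂ) * Complex.exp (Complex.I * ((2 * n : ℤ) : ℂ) * φ) := by
  rw [fourierCoeff_eq_intervalIntegral _ _ (-π), neg_add_cancel]
  congr 1
  refine intervalIntegral.integral_congr fun φ _ => ?_
  simp only [neg_neg, fourier_coe_apply, circleSymbol_coe, smul_eq_mul]
  rw [mul_comm]
  congr 2
  push_cast
  field_simp

lemma integral_eq_integral_even_part {σ : ℝ → ℝ} (hσ : Continuous σ) (n : ℤ) :
    ∫ φ in (-π)..π, (σ φ : ℂ) * Complex.exp (Complex.I * ((2 * n : ℤ) : ℂ) * φ) =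
      2 * ∫ φ in (-π)..0, (((σ φ + σ (φ + π)) / 2 : ℝ) : ℂ) *
        Complex.exp (Complex.I * ((2 * n : ℤ) : ℂ) * φ) := by
  set e : ℝ → ℂ := fun φ => Complex.exp (Complex.I * ((2 * n : ℤ) : ℂ) * φ) with he
  have hec : Continuous e := by fun_prop
  have he' : ∀ φ, e (φ + π) = e φ := fun φ =>
    Complex.exp_eq_exp_iff_exists_int.2 ⟨n, by push_cast; ring⟩
  have hint : ∀ a b, IntervalIntegrable (fun φ => (σ φ : ℂ) * e φ) volume a b := fun a b =>
    Continuous.intervalIntegrable (by fun_prop) _ _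
  rw [← intervalIntegral.integral_add_adjacent_intervals (hint (-π) 0) (hint 0 π)]
  have hshift := intervalIntegral.integral_comp_add_right (a := -π) (b := 0)
    (fun φ => (σ φ : ℂ) * e φ) π
  rw [neg_add_cancel, zero_add] at hshift
  rw [← hshift, ← intervalIntegral.integral_add (hint _ _)
    (Continuous.intervalIntegrable (by fun_prop) _ _), ← intervalIntegral.integral_const_mul]
  refine intervalIntegral.integral_congr fun φ _ => ?_
  change (σ φ : ℂ) * e φ + σ (φ + π) * e (φ + π) = 2 * (((σ φ + σ (φ + π)) / 2 : ℝ) * e φ)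
  rw [he']
  push_cast
  ring

lemma Wmat_eq [Fact (0 < π)] (ω : ℝ → ℝ) {σ : ℝ → ℝ} (hσ : Continuous σ)
    (hs : Continuous fun φ => (σ φ + σ (φ + π)) / 2)
    (hper : Function.Periodic (fun φ => (σ φ + σ (φ + π)) / 2) π) (ℓ : ℕ) :
    Wmat ω σ ℓ = window ω ℓ * toeplitz (ℓ - 1) (circleSymbol _ hs hper) * window ω ℓ := by
  ext j k
  rw [window, Matrix.mul_diagonal, Matrix.diagonal_mul, toeplitz_apply,
    show ((k : ℤ) - j) = -(j - k) by ring, fourierCoeff_circleSymbol, Wmat,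
    integral_eq_integral_even_part hσ, Complex.real_smul]
  push_cast
  field_simp

lemma norm_Wmat_le [Fact (0 < π)] {ω σ : ℝ → ℝ} {M : ℝ} (hM0 : 0 ≤ M) (hM : ∀ x, |ω x| ≤ M)
    (hσ : Continuous σ) (hs : Continuous fun φ => (σ φ + σ (φ + π)) / 2)
    (hper : Function.Periodic (fun φ => (σ φ + σ (φ + π)) / 2) π) (ℓ : ℕ) :
    ‖Wmat ω σ ℓ‖ ≤ M * ‖circleSymbol _ hs hper‖ * M := by
  rw [Wmat_eq ω hσ hs hper]
  refine norm_mul₃_le.trans ?_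
  have h1 := norm_window_le hM0 hM ℓ
  have h2 := norm_toeplitz_le (ℓ - 1) (circleSymbol _ hs hper)
  gcongr

lemma integral_circleSymbol_pow [Fact (0 < π)] {s : ℝ → ℝ} (hs : Continuous s)
    (hper : Function.Periodic s π) (p : ℕ) :
    fourierCoeff (circleSymbol s hs hper ^ p : C(AddCircle π, ℂ)) 0 =
      (((1 / (2 * π)) * ∫ φ in (-π)..π, s φ ^ p : ℝ) : ℂ) := by
  have hsp : Function.Periodic (fun φ => s φ ^ p) π := fun x => by simp only [hper x]
  have h2 : ∫ φ in (-π)..π, s φ ^ p = 2 * ∫ φ in (-π)..0, s φ ^ p := by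
    have hint : ∀ a b, IntervalIntegrable (fun φ => s φ ^ p) volume a b := fun a b =>
      Continuous.intervalIntegrable (by fun_prop) _ _
    rw [← intervalIntegral.integral_add_adjacent_intervals (hint (-π) 0) (hint 0 π)]
    have := hsp.intervalIntegral_add_eq 0 (-π)
    rw [zero_add, neg_add_cancel] at this
    rw [this]; ring
  rw [fourierCoeff_eq_intervalIntegral _ _ (-π), neg_add_cancel, h2]
  simp only [ContinuousMap.pow_apply, circleSymbol_coe, neg_zero, fourier_zero, one_smul]
  rw [Complex.real_smul]
  simp only [← Complex.ofReal_pow]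
  rw [intervalIntegral.integral_ofReal, ← Complex.ofReal_mul]
  congr 1
  field_simp

end Symbol

theorem tendsto_average_eigenvalues_polynomial [Fact (0 < π)]
    {ω σ : ℝ → ℝ} (hω : Continuous ω)
    (hωsupp : HasCompactSupport ω) (hωsub : tsupport ω ⊆ Set.Ioo (-1 : ℝ) 1)
    (hσ : Continuous σ) (hs : Continuous fun φ => (σ φ + σ (φ + π)) / 2)
    (hper : Function.Periodic (fun φ => (σ φ + σ (φ + π)) / 2) π)
    (hH : ∀ ℓ : ℕ, (Wmat ω σ ℓ).IsHermitian) (P : Polynomial ℝ) :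
    Tendsto
      (fun ℓ : ℕ => (1 / ((ℓ : ℝ) + 1)) * ∑ k, P.eval ((hH ℓ).eigenvalues k)) atTop
      (nhds ((1 / (4 * π)) * ∫ φ in (-π)..π, ∫ ξ in (-1 : ℝ)..(1 : ℝ),
          P.eval ((ω ξ) ^ 2 * ((σ φ + σ (φ + π)) / 2)))) := by
  set s : ℝ → ℝ := fun φ => (σ φ + σ (φ + π)) / 2
  change Tendsto _ _ (nhds ((1 / (4 * π)) * ∫ φ in (-π)..π, ∫ ξ in (-1 : ℝ)..(1 : ℝ),
          P.eval ((ω ξ) ^ 2 * s φ)))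
  induction P using Polynomial.induction_on' with
  | add P Q hP hQ =>
    have h := hP.add hQ
    simp only [Polynomial.eval_add]
    convert h using 2
    · rw [Finset.sum_add_distrib, mul_add]
    · rw [← mul_add, ← intervalIntegral.integral_add
        ((continuous_integral_symbol hω hs P.continuous).intervalIntegrable _ _)
        ((continuous_integral_symbol hω hs Q.continuous).intervalIntegrable _ _)]
      congr 1
      refine intervalIntegral.integral_congr fun φ _ => ?_
      exact intervalIntegral.integral_add
        (Continuous.intervalIntegrable (by fun_prop) _ _)
        (Continuous.intervalIntegrable (by fun_prop) _ _)
  | monomial p a =>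
    simp only [Polynomial.eval_monomial]
    rcases eq_or_ne p 0 with rfl | hp
    · have hlim : Tendsto (fun ℓ : ℕ => a * ((ℓ : ℝ) / (ℓ + 1) - 1 / (ℓ + 1))) atTop (nhds a) := by
        have := ((tendsto_natCast_div_add_atTop (𝕜 := ℝ) 1).sub
          (tendsto_one_div_add_atTop_nhds_zero_nat (𝕜 := ℝ))).const_mul a
        simpa using this
      have hval : (1 / (4 * π)) * ∫ φ in (-π)..π, ∫ ξ in (-1 : ℝ)..(1 : ℝ),
          a * ((ω ξ) ^ 2 * s φ) ^ 0 = a := by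
        simp only [pow_zero, mul_one, intervalIntegral.integral_const, smul_eq_mul]
        field_simp
        norm_num
      rw [hval]
      refine hlim.congr' ?_
      filter_upwards [eventually_ge_atTop 1] with ℓ hℓ
      simp [Nat.cast_sub hℓ]
      ring
    · have h := tendsto_trace_windowed_pow hω hωsupp hωsub (circleSymbol s hs hper) hp
      rw [integral_circleSymbol_pow, ← Complex.ofReal_mul] at h
      have h' := (((Complex.continuous_re.tendsto _).comp h).const_mul a)
      rw [Complex.ofReal_re] at h'
      convert h' using 2 with ℓ
      · rw [Function.comp_apply, ← Wmat_eq ω hσ hs hper, ← sum_eigenvalues_pow (hH ℓ),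
          ← Complex.ofReal_mul, Complex.ofReal_re, ← Finset.mul_sum]
        ring
      · have : ∀ φ ξ, a * (ω ξ ^ 2 * s φ) ^ p = (a * s φ ^ p) * ω ξ ^ (2 * p) := by
          intro φ ξ; rw [mul_pow, ← pow_mul]; ring
        simp only [this, intervalIntegral.integral_const_mul, intervalIntegral.integral_mul_const]
        field_simp
        ring

theorem tendsto_average_eigenvalues {ω σ : ℝ → ℝ} (hω : Continuous ω)
    (hωsupp : HasCompactSupport ω) (hωsub : tsupport ω ⊆ Set.Ioo (-1 : ℝ) 1)
    (hσ : Continuous σ) (hper : Function.Periodic σ (2 * π))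
    (hH : ∀ ℓ : ℕ, (Wmat ω σ ℓ).IsHermitian) {f : ℝ → ℝ} (hf : Continuous f) :
    Tendsto
      (fun ℓ : ℕ => (1 / ((ℓ : ℝ) + 1)) * ∑ k, f ((hH ℓ).eigenvalues k)) atTop
      (nhds ((1 / (4 * π)) * ∫ φ in (-π)..π, ∫ ξ in (-1 : ℝ)..(1 : ℝ),
          f ((ω ξ) ^ 2 * ((σ φ + σ (φ + π)) / 2)))) := by
  have : Fact (0 < π) := ⟨Real.pi_pos⟩
  have hs : Continuous fun φ => (σ φ + σ (φ + π)) / 2 := by fun_prop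
  have hsper : Function.Periodic (fun φ => (σ φ + σ (φ + π)) / 2) π := by
    intro φ
    have : φ + π + π = φ + 2 * π := by ring
    simp only [this, hper φ]
    ring
  obtain ⟨M, hM⟩ := hωsupp.exists_bound_of_continuous hω
  have hM0 : 0 ≤ M := (norm_nonneg _).trans (hM 0)
  set g := circleSymbol _ hs hsper with hg
  set B := M * ‖g‖ * M with hB
  have heig : ∀ ℓ k, |(hH ℓ).eigenvalues k| ≤ B := by
    intro ℓ k
    exact (abs_eigenvalues_le (hH ℓ) k).trans (norm_Wmat_le hM0 hM hσ hs hsper ℓ)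
  have hsym : ∀ ξ φ, |ω ξ ^ 2 * ((σ φ + σ (φ + π)) / 2)| ≤ B := by
    intro ξ φ
    have h1 : |(σ φ + σ (φ + π)) / 2| ≤ ‖g‖ := by
      have := g.norm_coe_le_norm (φ : AddCircle π)
      rwa [hg, circleSymbol_coe, Complex.norm_real] at this
    have h2 : |ω ξ| ≤ M := hM ξ
    rw [abs_mul, abs_pow]
    calc _ ≤ M ^ 2 * ‖g‖ := by gcongr
      _ = B := by rw [hB]; ring
  rw [Metric.tendsto_atTop]
  intro ε hε
  obtain ⟨P, hP⟩ := exists_polynomial_near_of_continuousOn (-B) B f hf.continuousOn (ε / 4)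
    (by positivity)
  have hP' : ∀ x, |x| ≤ B → |P.eval x - f x| ≤ ε / 4 := fun x hx => (hP x (abs_le.1 hx)).le
  obtain ⟨N, hN⟩ := Metric.tendsto_atTop.1
    (tendsto_average_eigenvalues_polynomial hω hωsupp hωsub hσ hs hsper hH P) (ε / 4)
    (by positivity)
  refine ⟨N, fun ℓ hℓ => ?_⟩
  have h1 := hN ℓ hℓ
  have h2 := abs_integral_symbol_sub_le hω hs P.continuous hf
    (fun ξ φ => hP' _ (hsym ξ φ))
  have h3 : |(1 / ((ℓ : ℝ) + 1)) * ∑ k, P.eval ((hH ℓ).eigenvalues k) -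
      (1 / ((ℓ : ℝ) + 1)) * ∑ k, f ((hH ℓ).eigenvalues k)| ≤ ε / 4 := by
    rw [← mul_sub, ← Finset.sum_sub_distrib, abs_mul, abs_of_pos (by positivity),
      one_div_mul_eq_div, div_le_iff₀ (by positivity)]
    refine (Finset.abs_sum_le_sum_abs _ _).trans
      ((Finset.sum_le_sum fun k _ => hP' _ (heig ℓ k)).trans ?_)
    have : ((ℓ - 1 : ℕ) : ℝ) ≤ ℓ := by exact_mod_cast Nat.sub_le _ _
    simp only [Finset.sum_const, Finset.card_univ, Fintype.card_fin, nsmul_eq_mul]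
    nlinarith
  rw [Real.dist_eq] at h1 ⊢
  rw [abs_lt] at h1 ⊢
  rw [abs_le] at h2 h3
  constructor <;> linarith [h1.1, h1.2, h2.1, h2.2, h3.1, h3.2]

theorem smooth_symbol_trace_asymptotics
    (ω : ℝ → ℝ) (hω : ContDiff ℝ (⊤ : ℕ∞) ω) (hω0 : ∀ x, 0 ≤ ω x)
    (hωsupp : HasCompactSupport ω) (hωsub : tsupport ω ⊆ Set.Ioo (-1 : ℝ) 1)
    (σ : ℝ → ℝ) (hσ : ContDiff ℝ 1 σ) (hper : Function.Periodic σ (2*Real.pi))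
    (hH : ∀ ℓ : ℕ, (Wmat ω σ ℓ).IsHermitian)
    (f : ℝ → ℝ) (hf : ContDiff ℝ (⊤ : ℕ∞) f) (hsupp : HasCompactSupport f) (hf0 : f 0 = 0) :
    Tendsto
      (fun ℓ : ℕ => (1/((ℓ:ℝ)+1)) * ∑ k, f ((hH ℓ).eigenvalues k))
      atTop
      (nhds ((1/(4*Real.pi)) *
        ∫ φ in (-Real.pi)..Real.pi, ∫ ξ in (-1:ℝ)..(1:ℝ),
          f ((ω ξ)^2 * ((σ φ + σ (φ + Real.pi))/2)))) := by
  exact tendsto_average_eigenvalues hω.continuous hωsupp hωsub hσ.continuous hper hH hf.continuous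
end

section
/- Let ω ∈ C^∞(ℝ) be nonnegative with compact support contained in (−1,1), and let σ : ℝ → ℝ be C¹, 2π-periodic, and satisfy σ(φ+π) = σ(φ) for all φ. Then for every integer p ≥ 1, lim_{ℓ→∞} (1/(ℓ+1)) · Tr( W_ℓ(ω,σ)^p ) = (1/(4π)) · ∫_{−π}^{π} ∫_{−1}^{1} ω(ξ)^{2p} · σ(φ)^p dξ dφ. -/
open Real Filter Finset

theorem summable_norm_fourierCoeffOn_of_contDiff {a b : ℝ} (hab : a < b) {f : ℝ → ℂ}
    (hf : ContDiff ℝ 1 f) (hfab : f a = f b) :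
    Summable fun n : ℤ => ‖fourierCoeffOn hab f n‖ := by
  have hcont : Continuous (deriv f) := hf.continuous_deriv le_rfl
  obtain ⟨C, hC⟩ :=
    isCompact_Icc.exists_bound_of_continuousOn (s := Set.Icc a b) hcont.continuousOn
  have hL2 : MeasureTheory.MemLp (deriv f) 2 (MeasureTheory.volume.restrict (Set.Ioc a b)) := by
    refine MeasureTheory.MemLp.of_bound hcont.aestronglyMeasurable C ?_
    filter_upwards [MeasureTheory.ae_restrict_mem measurableSet_Ioc] with x hx
    exact hC x (Set.Ioc_subset_Icc_self hx)
  have h1 := (hasSum_sq_fourierCoeffOn hab hL2).summable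
  have h2 : Summable fun n : ℤ => 1 / (n : ℝ) ^ 2 :=
    Real.summable_one_div_int_pow.mpr (by norm_num)
  refine Summable.of_norm_bounded_eventually
    ((h1.add h2).mul_left ((b - a) / (2 * π))) ?_
  filter_upwards [(Set.finite_singleton (0 : ℤ)).compl_mem_cofinite] with n hn
  have hn0 : n ≠ 0 := by simpa using hn
  have hba : 0 < b - a := sub_pos.mpr hab
  rw [fourierCoeffOn_of_hasDerivAt hab hn0
    (fun x _ => (hf.differentiable one_ne_zero x).hasDerivAt) (hcont.intervalIntegrable a b), hfab]
  set c := fourierCoeffOn hab (deriv f) n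
  have hc : ‖((b : ℂ) - a)‖ = b - a := by
    rw [← Complex.ofReal_sub, Complex.norm_real, Real.norm_of_nonneg hba.le]
  have hnpos : (0 : ℝ) < |(n : ℝ)| := by positivity
  simp only [sub_self, mul_zero, zero_sub, abs_norm, norm_mul, norm_neg, norm_div, hc, norm_one,
    Complex.norm_I, Complex.norm_real, Complex.norm_intCast, Complex.norm_ofNat, mul_one,
    Real.norm_of_nonneg pi_pos.le, Real.norm_of_nonneg hba.le, Real.norm_eq_abs, abs_abs,
    Nat.abs_ofNat]
  rw [← sq_abs (n : ℝ)]
  have key : ‖c‖ / |(n : ℝ)| ≤ ‖c‖ ^ 2 + 1 / |(n : ℝ)| ^ 2 := by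
    have := sq_nonneg (‖c‖ - 1 / |(n : ℝ)|)
    have h3 : 0 ≤ ‖c‖ * (1 / |(n : ℝ)|) := by positivity
    rw [div_eq_mul_one_div, ← one_div_pow]
    nlinarith
  calc _ = (b - a) / (2 * π) * (‖c‖ / |(n : ℝ)|) := by field_simp
    _ ≤ _ := by gcongr

/-- The Fourier coefficient of `σ` at the even frequency `-2n`. -/
noncomputable def evenCoeff (σ : ℝ → ℝ) (n : ℤ) : ℂ :=
  (1 / (2 * π) : ℝ) *
    ∫ φ in (-π)..π, (σ φ : ℂ) * Complex.exp (Complex.I * ((2 * n : ℤ) : ℂ) * (φ : ℂ))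

theorem evenCoeff_eq_fourierCoeffOn {σ : ℝ → ℝ} (hσ : Continuous σ)
    (hπper : ∀ φ, σ (φ + π) = σ φ) (n : ℤ) :
    evenCoeff σ n = fourierCoeffOn pi_pos (fun φ => (σ φ : ℂ)) (-n) := by
  set g : ℝ → ℂ := fun φ => (σ φ : ℂ) * Complex.exp (Complex.I * ((2 * n : ℤ) : ℂ) * (φ : ℂ))
    with hg
  have hgper : Function.Periodic g π := fun φ => by
    simp only [hg, hπper]
    congr 1
    refine Complex.exp_eq_exp_iff_exists_int.mpr ⟨n, ?_⟩
    push_cast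
    ring
  have hgc : Continuous g := by fun_prop
  have hsplit : ∫ φ in (-π)..π, g φ = 2 * ∫ φ in (0 : ℝ)..π, g φ := by
    have h := hgper.intervalIntegral_add_eq (-π) 0
    rw [neg_add_cancel, zero_add] at h
    rw [← intervalIntegral.integral_add_adjacent_intervals (hgc.intervalIntegrable (-π) 0)
      (hgc.intervalIntegrable 0 π), h]
    ring
  rw [evenCoeff, hsplit, fourierCoeffOn_eq_integral]
  have : ∀ x : ℝ, fourier (- -n) (x : AddCircle (π - 0)) • (σ x : ℂ) = g x := fun x => by
    rw [fourier_coe_apply, smul_eq_mul, mul_comm, hg]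
    congr 2
    have : (π : ℂ) ≠ 0 := by exact_mod_cast pi_ne_zero
    push_cast
    rw [sub_zero, neg_neg]
    field_simp
  simp_rw [this]
  rw [Complex.real_smul]
  have : (π : ℂ) ≠ 0 := by exact_mod_cast pi_ne_zero
  push_cast
  rw [sub_zero]
  field_simp

theorem summable_norm_evenCoeff {σ : ℝ → ℝ} (hσ : ContDiff ℝ 1 σ) (hπper : ∀ φ, σ (φ + π) = σ φ) :
    Summable fun n : ℤ => ‖evenCoeff σ n‖ := by
  simp_rw [evenCoeff_eq_fourierCoeffOn hσ.continuous hπper]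
  have h := summable_norm_fourierCoeffOn_of_contDiff pi_pos (f := fun φ => (σ φ : ℂ))
    (Complex.ofRealCLM.contDiff.comp hσ) (by rw [← hπper 0, zero_add])
  exact (Equiv.neg ℤ).summable_iff.mpr h

theorem hasSum_evenCoeff_mul_exp {σ : ℝ → ℝ} (hσ : ContDiff ℝ 1 σ)
    (hπper : ∀ φ, σ (φ + π) = σ φ) (φ : ℝ) :
    HasSum (fun n : ℤ => evenCoeff σ n * Complex.exp (Complex.I * ((2 * -n : ℤ) : ℂ) * (φ : ℂ)))
      (σ φ : ℂ) := by
  have hper : Function.Periodic (fun φ => (σ φ : ℂ)) π := fun φ => by simp only [hπper]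
  have : Fact (0 < π) := ⟨pi_pos⟩
  let F : C(AddCircle π, ℂ) := ⟨hper.lift, by
    have : Continuous fun φ => (σ φ : ℂ) := Complex.continuous_ofReal.comp hσ.continuous
    exact this.quotient_lift _⟩
  have hF : ∀ x : ℝ, F (x : AddCircle π) = σ x := fun x => hper.lift_coe x
  have hcoeff : ∀ n : ℤ, fourierCoeff F n = evenCoeff σ (-n) := fun n => by
    rw [evenCoeff_eq_fourierCoeffOn hσ.continuous hπper, neg_neg, fourierCoeffOn_eq_integral,
      fourierCoeff_eq_intervalIntegral _ _ 0]
    simp only [hF, zero_add, fourier_coe_apply, sub_zero]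
  have hsum : Summable (fourierCoeff F) := by
    refine Summable.of_norm ?_
    simp_rw [hcoeff]
    exact (Equiv.neg ℤ).summable_iff.mpr (summable_norm_evenCoeff hσ hπper)
  have h := has_pointwise_sum_fourier_series_of_summable hsum (φ : AddCircle π)
  rw [hF, ← (Equiv.neg ℤ).hasSum_iff] at h
  convert h using 2 with n
  simp only [Function.comp_apply, Equiv.neg_apply, hcoeff, neg_neg, fourier_coe_apply, smul_eq_mul]
  congr 2
  have : (π : ℂ) ≠ 0 := by exact_mod_cast pi_ne_zero
  push_cast
  field_simp

/-- The sample point `m_j / ℓ` of the matrix `Wmat ω σ ℓ`. -/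
noncomputable def node (ℓ : ℕ) (j : ℤ) : ℝ := ((2 * j - (ℓ : ℤ) + 2 : ℤ) : ℝ) / (ℓ : ℝ)

/-- The plane wave of frequency `2j`. -/
noncomputable def wave (φ : ℝ) (j : ℤ) : ℂ := Complex.exp (Complex.I * ((2 * j : ℤ) : ℂ) * (φ : ℂ))

theorem Wmat_apply (ω σ : ℝ → ℝ) (ℓ : ℕ) (j k : Fin (ℓ - 1)) :
    Wmat ω σ ℓ j k = ω (node ℓ j) * ω (node ℓ k) * evenCoeff σ (j - k) := by
  simp only [Wmat, node, evenCoeff]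
  push_cast
  ring

theorem norm_wave (φ : ℝ) (j : ℤ) : ‖wave φ j‖ = 1 := by
  have : Complex.I * ((2 * j : ℤ) : ℂ) * (φ : ℂ) = ((2 * j * φ : ℝ) : ℂ) * Complex.I := by
    push_cast
    ring
  rw [wave, this, Complex.norm_exp_ofReal_mul_I]

theorem wave_add (φ : ℝ) (j k : ℤ) : wave φ (j + k) = wave φ j * wave φ k := by
  rw [wave, wave, wave, ← Complex.exp_add]
  congr 1
  push_cast
  ring

theorem continuous_wave (j : ℤ) : Continuous fun φ => wave φ j := by
  unfold wave
  fun_prop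

theorem integral_wave (n : ℤ) :
    ∫ φ in (-π)..π, wave φ n = if n = 0 then ((2 * π : ℝ) : ℂ) else 0 := by
  split_ifs with h
  · subst h
    simp only [wave, mul_zero, Int.cast_zero, zero_mul, Complex.exp_zero,
      intervalIntegral.integral_const, sub_neg_eq_add, Complex.real_smul, mul_one]
    push_cast
    ring
  · have hc : Complex.I * ((2 * n : ℤ) : ℂ) ≠ 0 :=
      mul_ne_zero Complex.I_ne_zero (by exact_mod_cast mul_ne_zero two_ne_zero h)
    have hper : Complex.exp (Complex.I * ((2 * n : ℤ) : ℂ) * (π : ℂ)) =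
        Complex.exp (Complex.I * ((2 * n : ℤ) : ℂ) * ((-π : ℝ) : ℂ)) :=
      Complex.exp_eq_exp_iff_exists_int.mpr ⟨2 * n, by push_cast; ring⟩
    simp only [wave]
    rw [integral_exp_mul_complex hc, hper, sub_self, zero_div]

theorem integral_wave_neg_mul_mulVec {N : ℕ} (A : Matrix (Fin N) (Fin N) ℂ) (j : Fin N) :
    ∫ φ in (-π)..π, wave φ (-(j : ℤ)) * (A.mulVec fun k => wave φ k) j =
      ((2 * π : ℝ) : ℂ) * A j j := by
  have h : ∀ φ, wave φ (-(j : ℤ)) * (A.mulVec fun k => wave φ k) j =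
      ∑ k : Fin N, A j k * wave φ (-(j : ℤ) + k) := fun φ => by
    simp only [Matrix.mulVec, dotProduct, Finset.mul_sum, wave_add]
    exact Finset.sum_congr rfl fun k _ => by ring
  simp_rw [h]
  rw [intervalIntegral.integral_finsetSum fun k _ =>
    ((continuous_wave _).const_mul (A j k)).intervalIntegrable _ _]
  simp_rw [intervalIntegral.integral_const_mul, integral_wave]
  rw [Finset.sum_eq_single j]
  · simp [mul_comm]
  · intro k _ hk
    have : -(j : ℤ) + k ≠ 0 := fun h => hk (Fin.ext (by omega))
    rw [if_neg this, mul_zero]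
  · simp

theorem abs_node_sub_node (ℓ : ℕ) (j n : ℤ) :
    |node ℓ (j - n) - node ℓ j| = 2 * |(n : ℝ)| / ℓ := by
  have : node ℓ (j - n) - node ℓ j = -(2 * n / ℓ) := by
    simp only [node]
    push_cast
    ring
  rw [this, abs_neg, abs_div, abs_mul, Nat.abs_ofNat, Nat.abs_cast]

theorem eq_natCast_of_node_mem_Ioo {ℓ : ℕ} (hℓ : 1 ≤ ℓ) {k : ℤ}
    (hk : node ℓ k ∈ Set.Ioo (-1 : ℝ) 1) :
    k ∈ Set.range fun i : Fin (ℓ - 1) => ((i : ℕ) : ℤ) := by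
  obtain ⟨h1, h2⟩ := hk
  have hℓ' : (0 : ℝ) < ℓ := by exact_mod_cast hℓ
  rw [node, lt_div_iff₀ hℓ'] at h1
  rw [node, div_lt_iff₀ hℓ'] at h2
  have h3 : -1 * (ℓ : ℤ) < 2 * k - ℓ + 2 := by exact_mod_cast h1
  have h4 : 2 * k - ℓ + 2 < 1 * (ℓ : ℤ) := by exact_mod_cast h2
  exact ⟨⟨k.toNat, by omega⟩, by simp; omega⟩

/-- A modulus of continuity at scale `1/ℓ`, averaged against summable weights, tends to zero. -/
theorem tendsto_tsum_norm_mul_min {a : ℤ → ℂ} (ha : Summable fun n => ‖a n‖) {M L : ℝ}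
    (hM : 0 ≤ M) (hL : 0 ≤ L) :
    Tendsto (fun ℓ : ℕ => ∑' n, ‖a n‖ * min M (L * (2 * |(n : ℝ)| / ℓ))) atTop (nhds 0) := by
  have h := tendsto_tsum_of_dominated_convergence (𝓕 := atTop)
    (f := fun (ℓ : ℕ) (n : ℤ) => ‖a n‖ * min M (L * (2 * |(n : ℝ)| / ℓ))) (g := fun _ => 0)
    (ha.mul_right M) (fun n => ?_) (Eventually.of_forall fun ℓ n => ?_)
  · simpa using h
  · have h1 : Tendsto (fun ℓ : ℕ => L * (2 * |(n : ℝ)| / ℓ)) atTop (nhds (L * 0)) :=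
      (tendsto_const_div_atTop_nhds_zero_nat _).const_mul L
    have h2 := (tendsto_const_nhds (x := M)).min h1
    rw [mul_zero, min_eq_right hM] at h2
    simpa using h2.const_mul ‖a n‖
  · rw [Real.norm_of_nonneg (by positivity)]
    gcongr
    exact min_le_left _ _

theorem sum_norm_sub_le_tsum {a : ℤ → ℂ} (ha : Summable fun n => ‖a n‖) {N : ℕ} (j : ℤ) :
    ∑ k : Fin N, ‖a (j - (k : ℕ))‖ ≤ ∑' n, ‖a n‖ := by
  have hinj : Function.Injective fun k : Fin N => j - ((k : ℕ) : ℤ) := fun k k' h =>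
    Fin.ext (by simpa using h)
  have := ha.sum_le_tsum (Finset.univ.map ⟨_, hinj⟩) fun _ _ => norm_nonneg _
  simpa using this

/-- A slowly varying amplitude passes through convolution with the Fourier coefficients of `σ`. -/
theorem norm_sum_mul_wave_sub_le {σ : ℝ → ℝ} (hσ : ContDiff ℝ 1 σ) (hπper : ∀ φ, σ (φ + π) = σ φ)
    {h : ℝ → ℝ} (hsupp : ∀ x ∉ Set.Ioo (-1 : ℝ) 1, h x = 0) {M : ℝ} {L : NNReal}
    (hM : ∀ x, |h x| ≤ M) (hL : LipschitzWith L h) {ℓ : ℕ} (hℓ : 1 ≤ ℓ) (φ : ℝ) (j : ℤ) :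
    ‖∑ k : Fin (ℓ - 1), (h (node ℓ k) : ℂ) * evenCoeff σ (j - k) * wave φ k
        - h (node ℓ j) * σ φ * wave φ j‖ ≤
      ∑' n, ‖evenCoeff σ n‖ * min (2 * M) (L * (2 * |(n : ℝ)| / ℓ)) := by
  have ha := summable_norm_evenCoeff hσ hπper
  have hM0 : 0 ≤ M := (abs_nonneg _).trans (hM 0)
  set f : ℤ → ℂ := fun k => (h (node ℓ k) : ℂ) * evenCoeff σ (j - k) * wave φ k with hf
  have hbound : ∀ n, ‖f (j - n) - h (node ℓ j) * (evenCoeff σ n * wave φ (-n)) * wave φ j‖ ≤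
      ‖evenCoeff σ n‖ * min (2 * M) (L * (2 * |(n : ℝ)| / ℓ)) := fun n => by
    have : f (j - n) - h (node ℓ j) * (evenCoeff σ n * wave φ (-n)) * wave φ j =
        evenCoeff σ n * ((h (node ℓ (j - n)) - h (node ℓ j) : ℝ) : ℂ) * wave φ (j - n) := by
      simp only [hf, sub_sub_cancel]
      rw [sub_eq_add_neg j n, wave_add]
      push_cast
      ring
    rw [this, norm_mul, norm_mul, norm_wave, mul_one, Complex.norm_real, Real.norm_eq_abs]
    gcongr
    refine le_min ?_ ?_
    · calc _ ≤ |h (node ℓ (j - n))| + |h (node ℓ j)| := abs_sub _ _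
        _ ≤ _ := by linarith [hM (node ℓ (j - n)), hM (node ℓ j)]
    · rw [← abs_node_sub_node ℓ j n]
      simpa [Real.dist_eq] using hL.dist_le_mul (node ℓ (j - n)) (node ℓ j)
  have hdom : Summable fun n : ℤ =>
      ‖evenCoeff σ n‖ * min (2 * M) (L * (2 * |(n : ℝ)| / ℓ)) :=
    Summable.of_nonneg_of_le (fun n => by positivity)
      (fun n => mul_le_mul_of_nonneg_left (min_le_left _ _) (norm_nonneg _)) (ha.mul_right (2 * M))
  have hsum : HasSum f (∑ k : Fin (ℓ - 1), f (k : ℕ)) := by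
    have hinj : Function.Injective fun i : Fin (ℓ - 1) => ((i : ℕ) : ℤ) := fun k k' h =>
      Fin.ext (by simpa using h)
    refine (hinj.hasSum_iff fun k hk => ?_).mp (hasSum_fintype _)
    have : h (node ℓ k) = 0 := hsupp _ fun hmem => hk (eq_natCast_of_node_mem_Ioo hℓ hmem)
    simp [hf, this]
  have hshift : HasSum (fun n => f (j - n)) (∑ k : Fin (ℓ - 1), f (k : ℕ)) :=
    (Equiv.subLeft j).hasSum_iff.mpr hsum
  have hmain : HasSum (fun n => h (node ℓ j) * (evenCoeff σ n * wave φ (-n)) * wave φ j)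
      (h (node ℓ j) * σ φ * wave φ j) :=
    ((hasSum_evenCoeff_mul_exp hσ hπper φ).mul_left _).mul_right _
  rw [← (hshift.sub hmain).tsum_eq]
  exact tsum_of_norm_bounded hdom.hasSum hbound

theorem tendsto_riemannSum_node {f : ℝ → ℝ} {L : NNReal} (hL : LipschitzWith L f) (h1 : f 1 = 0) :
    Tendsto (fun ℓ : ℕ => (2 / (ℓ : ℝ)) * ∑ j : Fin (ℓ - 1), f (node ℓ j)) atTop
      (nhds (∫ x in (-1 : ℝ)..1, f x)) := by
  have hbd : ∀ᶠ ℓ : ℕ in atTop,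
      ‖(2 / (ℓ : ℝ)) * ∑ j : Fin (ℓ - 1), f (node ℓ j) - ∫ x in (-1 : ℝ)..1, f x‖ ≤
        4 * L / (ℓ : ℝ) := by
    filter_upwards [eventually_ge_atTop 1] with ℓ hℓ
    have hℓ0 : (0 : ℝ) < ℓ := by exact_mod_cast hℓ
    set x : ℕ → ℝ := fun i => -1 + 2 * i / ℓ with hx
    have hstep : ∀ i, x (i + 1) - x i = 2 / ℓ := fun i => by
      simp only [hx]
      push_cast
      ring
    have hmono : ∀ i, x i ≤ x (i + 1) := fun i => by
      have : 0 ≤ 2 / (ℓ : ℝ) := by positivity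
      linarith [hstep i]
    have hint : ∀ a b, IntervalIntegrable f MeasureTheory.volume a b :=
      hL.continuous.intervalIntegrable
    have hx0 : x 0 = -1 := by simp [hx]
    have hxℓ : x ℓ = 1 := by
      simp only [hx]
      field_simp
      norm_num
    have hI : ∫ x in (-1 : ℝ)..1, f x = ∑ i ∈ range ℓ, ∫ t in x i..x (i + 1), f t := by
      rw [intervalIntegral.sum_integral_adjacent_intervals fun k _ => hint _ _, hx0, hxℓ]
    have hS : ∑ j : Fin (ℓ - 1), f (node ℓ j) = ∑ i ∈ range ℓ, f (x (i + 1)) := by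
      obtain ⟨m, rfl⟩ : ∃ m, ℓ = m + 1 := ⟨ℓ - 1, by omega⟩
      rw [Finset.sum_range_succ, hxℓ, h1, add_zero, Finset.sum_range]
      refine Finset.sum_congr rfl fun j _ => ?_
      congr 1
      simp only [node, hx]
      push_cast at hℓ0 ⊢
      field_simp
      ring
    rw [hI, hS, Finset.mul_sum, ← Finset.sum_sub_distrib]
    have hterm : ∀ i ∈ range ℓ, ‖2 / (ℓ : ℝ) * f (x (i + 1)) - ∫ t in x i..x (i + 1), f t‖ ≤
        L * (2 / ℓ) * (2 / ℓ) := fun i _ => by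
      have : 2 / (ℓ : ℝ) * f (x (i + 1)) = ∫ _ in x i..x (i + 1), f (x (i + 1)) := by
        rw [intervalIntegral.integral_const, hstep, smul_eq_mul]
      rw [this, ← intervalIntegral.integral_sub intervalIntegrable_const (hint _ _)]
      refine (intervalIntegral.norm_integral_le_of_norm_le_const
        (C := L * (2 / ℓ)) fun t ht => ?_).trans_eq ?_
      · rw [Set.uIoc_of_le (hmono i)] at ht
        rw [← dist_eq_norm]
        refine (hL.dist_le_mul _ _).trans ?_
        gcongr
        rw [Real.dist_eq, abs_of_nonneg (by linarith [ht.2])]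
        linarith [ht.1, hstep i]
      · rw [hstep, abs_of_nonneg (by positivity)]
    refine (norm_sum_le_of_le _ hterm).trans_eq ?_
    rw [Finset.sum_const, card_range, nsmul_eq_mul]
    field_simp
    norm_num
  rw [tendsto_iff_norm_sub_tendsto_zero]
  exact squeeze_zero' (Eventually.of_forall fun _ => norm_nonneg _) hbd
    (tendsto_const_div_atTop_nhds_zero_nat _)

/-- One application of `Wmat ω σ ℓ` to an amplitude `ω ^ m` on a plane wave multiplies it by
`ω ^ 2 * σ`, up to a uniformly small error. -/
theorem exists_tendsto_norm_Wmat_mulVec_sub_le {ω σ : ℝ → ℝ} (hω : ContDiff ℝ 1 ω)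
    (hωsupp : HasCompactSupport ω) (hωsub : tsupport ω ⊆ Set.Ioo (-1 : ℝ) 1)
    (hσ : ContDiff ℝ 1 σ) (hπper : ∀ φ, σ (φ + π) = σ φ) (m : ℕ) :
    ∃ δ : ℕ → ℝ, Tendsto δ atTop (nhds 0) ∧ ∀ (ℓ : ℕ) (φ : ℝ) (j : Fin (ℓ - 1)),
      ‖(Wmat ω σ ℓ).mulVec (fun k => (ω (node ℓ k) : ℂ) ^ m * wave φ k) j
        - (ω (node ℓ j) : ℂ) ^ (m + 2) * σ φ * wave φ j‖ ≤ δ ℓ := by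
  obtain ⟨M, hM⟩ := hωsupp.exists_bound_of_continuous hω.continuous
  have hM0 : 0 ≤ M := (norm_nonneg _).trans (hM 0)
  obtain ⟨L, hL⟩ := (hω.pow (m + 1)).lipschitzWith_of_hasCompactSupport
    (hωsupp.comp_left (g := fun x : ℝ => x ^ (m + 1)) (by simp)) one_ne_zero
  have hbd : ∀ x, |ω x ^ (m + 1)| ≤ M ^ (m + 1) := fun x => by
    rw [abs_pow]
    exact pow_le_pow_left₀ (abs_nonneg _) (hM x) _
  have hsupp : ∀ x ∉ Set.Ioo (-1 : ℝ) 1, ω x ^ (m + 1) = 0 := fun x hx => by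
    rw [image_eq_zero_of_notMem_tsupport fun h => hx (hωsub h), zero_pow m.succ_ne_zero]
  refine ⟨fun ℓ => M * ∑' n, ‖evenCoeff σ n‖ * min (2 * M ^ (m + 1)) (L * (2 * |(n : ℝ)| / ℓ)),
    ?_, fun ℓ φ j => ?_⟩
  · simpa using (tendsto_tsum_norm_mul_min (summable_norm_evenCoeff hσ hπper)
      (by positivity : 0 ≤ 2 * M ^ (m + 1)) L.coe_nonneg).const_mul M
  · have hℓ : 1 ≤ ℓ := by have := j.2; omega
    have h := norm_sum_mul_wave_sub_le hσ hπper hsupp hbd hL hℓ φ j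
    have heq : (Wmat ω σ ℓ).mulVec (fun k => (ω (node ℓ k) : ℂ) ^ m * wave φ k) j
        - (ω (node ℓ j) : ℂ) ^ (m + 2) * σ φ * wave φ j = ω (node ℓ j) *
        (∑ k : Fin (ℓ - 1), ((ω (node ℓ k) ^ (m + 1) : ℝ) : ℂ) * evenCoeff σ (j - k) * wave φ k
        - ((ω (node ℓ j) ^ (m + 1) : ℝ) : ℂ) * σ φ * wave φ j) := by
      rw [mul_sub, Finset.mul_sum]
      simp only [Matrix.mulVec, dotProduct, Wmat_apply]
      push_cast
      congr 1
      · exact Finset.sum_congr rfl fun k _ => by ring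
      · ring
    rw [heq, norm_mul, Complex.norm_real]
    exact mul_le_mul (hM _) h (norm_nonneg _) hM0

theorem exists_norm_Wmat_mulVec_le {ω σ : ℝ → ℝ} (hω : Continuous ω)
    (hωsupp : HasCompactSupport ω) (hσ : ContDiff ℝ 1 σ) (hπper : ∀ φ, σ (φ + π) = σ φ) :
    ∃ C : ℝ, ∀ (ℓ : ℕ) (v : Fin (ℓ - 1) → ℂ) (ε : ℝ), (∀ k, ‖v k‖ ≤ ε) →
      ∀ j, ‖(Wmat ω σ ℓ).mulVec v j‖ ≤ C * ε := by
  obtain ⟨M, hM⟩ := hωsupp.exists_bound_of_continuous hω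
  have hM0 : 0 ≤ M := (norm_nonneg _).trans (hM 0)
  refine ⟨M * M * ∑' n, ‖evenCoeff σ n‖, fun ℓ v ε hv j => ?_⟩
  have hε : 0 ≤ ε := (norm_nonneg _).trans (hv j)
  calc ‖(Wmat ω σ ℓ).mulVec v j‖
      ≤ ∑ k : Fin (ℓ - 1), M * M * ‖evenCoeff σ (j - (k : ℕ))‖ * ε := by
        rw [Matrix.mulVec, dotProduct]
        refine norm_sum_le_of_le _ fun k _ => ?_
        rw [Wmat_apply, norm_mul, norm_mul, norm_mul, Complex.norm_real, Complex.norm_real]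
        gcongr
        exacts [hM _, hM _, hv k]
    _ = M * M * (∑ k : Fin (ℓ - 1), ‖evenCoeff σ (j - (k : ℕ))‖) * ε := by
        rw [Finset.mul_sum, Finset.sum_mul]
    _ ≤ _ := by
        gcongr
        exact sum_norm_sub_le_tsum (summable_norm_evenCoeff hσ hπper) j

theorem exists_tendsto_norm_Wmat_pow_mulVec_sub_le {ω σ : ℝ → ℝ} (hω : ContDiff ℝ 1 ω)
    (hωsupp : HasCompactSupport ω) (hωsub : tsupport ω ⊆ Set.Ioo (-1 : ℝ) 1)
    (hσ : ContDiff ℝ 1 σ) (hper : Function.Periodic σ (2 * π))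
    (hπper : ∀ φ, σ (φ + π) = σ φ) (p : ℕ) :
    ∃ δ : ℕ → ℝ, Tendsto δ atTop (nhds 0) ∧ ∀ (ℓ : ℕ) (φ : ℝ) (j : Fin (ℓ - 1)),
      ‖(Wmat ω σ ℓ ^ p).mulVec (fun k => wave φ k) j
        - (ω (node ℓ j) : ℂ) ^ (2 * p) * (σ φ : ℂ) ^ p * wave φ j‖ ≤ δ ℓ := by
  obtain ⟨S, hS⟩ : ∃ S, ∀ φ, |σ φ| ≤ S := by
    obtain ⟨S, hS⟩ :=
      (hper.isBounded_of_continuous two_pi_pos.ne' hσ.continuous).exists_norm_le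
    exact ⟨S, fun φ => hS _ (Set.mem_range_self φ)⟩
  have hS0 : 0 ≤ S := (abs_nonneg _).trans (hS 0)
  obtain ⟨C, hC⟩ := exists_norm_Wmat_mulVec_le hω.continuous hωsupp hσ hπper
  induction p with
  | zero => exact ⟨fun _ => 0, tendsto_const_nhds, by simp⟩
  | succ p ih =>
    obtain ⟨δ, hδ, hbound⟩ := ih
    obtain ⟨η, hη, hstep⟩ :=
      exists_tendsto_norm_Wmat_mulVec_sub_le hω hωsupp hωsub hσ hπper (2 * p)
    refine ⟨fun ℓ => C * δ ℓ + S ^ p * η ℓ, ?_, fun ℓ φ j => ?_⟩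
    · simpa using (hδ.const_mul C).add (hη.const_mul (S ^ p))
    set r : Fin (ℓ - 1) → ℂ := fun j => (Wmat ω σ ℓ ^ p).mulVec (fun k => wave φ k) j
        - (ω (node ℓ j) : ℂ) ^ (2 * p) * (σ φ : ℂ) ^ p * wave φ j with hr
    set u : Fin (ℓ - 1) → ℂ := fun k => (ω (node ℓ k) : ℂ) ^ (2 * p) * wave φ k with hu
    have hsplit : (Wmat ω σ ℓ ^ p).mulVec (fun k => wave φ k) = r + (σ φ : ℂ) ^ p • u := by
      ext k
      simp only [hr, hu, Pi.add_apply, Pi.smul_apply, smul_eq_mul]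
      ring
    have heq : (Wmat ω σ ℓ ^ (p + 1)).mulVec (fun k => wave φ k) j
        - (ω (node ℓ j) : ℂ) ^ (2 * (p + 1)) * (σ φ : ℂ) ^ (p + 1) * wave φ j =
        (Wmat ω σ ℓ).mulVec r j + (σ φ : ℂ) ^ p * ((Wmat ω σ ℓ).mulVec u j
          - (ω (node ℓ j) : ℂ) ^ (2 * p + 2) * σ φ * wave φ j) := by
      rw [pow_succ', ← Matrix.mulVec_mulVec, hsplit, Matrix.mulVec_add, Matrix.mulVec_smul]
      simp only [Pi.add_apply, Pi.smul_apply, smul_eq_mul]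
      ring
    rw [heq]
    refine (norm_add_le _ _).trans (add_le_add (hC ℓ r _ (hbound ℓ φ) j) ?_)
    rw [norm_mul, norm_pow, Complex.norm_real]
    gcongr
    exacts [hS φ, hstep ℓ φ j]

theorem exists_tendsto_norm_Wmat_pow_diag_sub_le {ω σ : ℝ → ℝ} (hω : ContDiff ℝ 1 ω)
    (hωsupp : HasCompactSupport ω) (hωsub : tsupport ω ⊆ Set.Ioo (-1 : ℝ) 1)
    (hσ : ContDiff ℝ 1 σ) (hper : Function.Periodic σ (2 * π))
    (hπper : ∀ φ, σ (φ + π) = σ φ) (p : ℕ) :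
    ∃ δ : ℕ → ℝ, Tendsto δ atTop (nhds 0) ∧ ∀ (ℓ : ℕ) (j : Fin (ℓ - 1)),
      ‖(Wmat ω σ ℓ ^ p) j j
        - ((ω (node ℓ j) ^ (2 * p) * (1 / (2 * π) * ∫ φ in (-π)..π, σ φ ^ p) : ℝ) : ℂ)‖ ≤ δ ℓ := by
  obtain ⟨δ, hδ, hbound⟩ :=
    exists_tendsto_norm_Wmat_pow_mulVec_sub_le hω hωsupp hωsub hσ hper hπper p
  refine ⟨δ, hδ, fun ℓ j => ?_⟩
  have hσc := hσ.continuous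
  set g : ℝ → ℂ := fun φ => wave φ (-(j : ℕ)) * (Wmat ω σ ℓ ^ p).mulVec (fun k => wave φ k) j
    with hg
  have hgc : Continuous g := by
    refine (continuous_wave _).mul ?_
    simp only [Matrix.mulVec, dotProduct]
    exact continuous_finsetSum _ fun k _ => continuous_const.mul (continuous_wave _)
  have hsc : Continuous fun φ => ((ω (node ℓ j) ^ (2 * p) * σ φ ^ p : ℝ) : ℂ) := by fun_prop
  have hint : ((2 * π : ℝ) : ℂ) * ((Wmat ω σ ℓ ^ p) j j
        - ((ω (node ℓ j) ^ (2 * p) * (1 / (2 * π) * ∫ φ in (-π)..π, σ φ ^ p) : ℝ) : ℂ)) =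
      ∫ φ in (-π)..π, (g φ - ((ω (node ℓ j) ^ (2 * p) * σ φ ^ p : ℝ) : ℂ)) := by
    rw [intervalIntegral.integral_sub (hgc.intervalIntegrable _ _) (hsc.intervalIntegrable _ _),
      integral_wave_neg_mul_mulVec, intervalIntegral.integral_ofReal,
      intervalIntegral.integral_const_mul, mul_sub, ← Complex.ofReal_mul (2 * π)]
    congr 2
    field_simp
  have hle : ‖∫ φ in (-π)..π, (g φ - ((ω (node ℓ j) ^ (2 * p) * σ φ ^ p : ℝ) : ℂ))‖ ≤
      δ ℓ * |π - -π| := by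
    refine intervalIntegral.norm_integral_le_of_norm_le_const fun φ _ => ?_
    have hone : wave φ (-(j : ℕ)) * wave φ j = 1 := by
      rw [← wave_add, neg_add_cancel]
      simp [wave]
    have : g φ - ((ω (node ℓ j) ^ (2 * p) * σ φ ^ p : ℝ) : ℂ) = wave φ (-(j : ℕ)) *
        ((Wmat ω σ ℓ ^ p).mulVec (fun k => wave φ k) j
          - (ω (node ℓ j) : ℂ) ^ (2 * p) * (σ φ : ℂ) ^ p * wave φ j) := by
      simp only [hg]
      push_cast
      linear_combination (-(ω (node ℓ j) : ℂ) ^ (2 * p) * (σ φ : ℂ) ^ p) * hone.symm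
    rw [this, norm_mul, norm_wave, one_mul]
    exact hbound ℓ φ j
  rw [← hint, norm_mul, Complex.norm_real, Real.norm_of_nonneg two_pi_pos.le,
    show π - -π = 2 * π by ring, abs_of_pos two_pi_pos, mul_comm (δ ℓ)] at hle
  exact le_of_mul_le_mul_left hle two_pi_pos

theorem trace_powers_asymptotics
    (ω : ℝ → ℝ) (hω : ContDiff ℝ (⊤ : ℕ∞) ω) (hω0 : ∀ x, 0 ≤ ω x)
    (hωsupp : HasCompactSupport ω) (hωsub : tsupport ω ⊆ Set.Ioo (-1 : ℝ) 1)
    (σ : ℝ → ℝ) (hσ : ContDiff ℝ 1 σ) (hper : Function.Periodic σ (2*Real.pi))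
    (hπper : ∀ φ : ℝ, σ (φ + Real.pi) = σ φ)
    (p : ℕ) (hp : 1 ≤ p) :
    Tendsto
      (fun ℓ : ℕ => (1/((ℓ:ℝ)+1) : ℂ) * Matrix.trace ((Wmat ω σ ℓ) ^ p))
      atTop
      (nhds (((1/(4*Real.pi)) *
        ∫ φ in (-Real.pi)..Real.pi, ∫ ξ in (-1:ℝ)..(1:ℝ),
          (ω ξ)^(2*p) * (σ φ)^p : ℝ) : ℂ)) := by
  have hω1 : ContDiff ℝ 1 ω := hω.of_le (by exact_mod_cast le_top)
  obtain ⟨δ, hδ, hbound⟩ :=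
    exists_tendsto_norm_Wmat_pow_diag_sub_le hω1 hωsupp hωsub hσ hper hπper p
  have hp0 : 2 * p ≠ 0 := by omega
  obtain ⟨L, hL⟩ : ∃ L, LipschitzWith L fun x => ω x ^ (2 * p) :=
    (hω1.pow (2 * p)).lipschitzWith_of_hasCompactSupport
    (hωsupp.comp_left (g := fun x : ℝ => x ^ (2 * p)) (by simp [hp0])) one_ne_zero
  have hend : ω 1 ^ (2 * p) = 0 := by
    rw [image_eq_zero_of_notMem_tsupport fun h => lt_irrefl _ (hωsub h).2, zero_pow hp0]
  set I := ∫ x in (-1 : ℝ)..1, ω x ^ (2 * p) with hI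
  set s := 1 / (2 * π) * ∫ φ in (-π)..π, σ φ ^ p with hs
  have hlim : (1 / (4 * π)) * ∫ φ in (-π)..π, ∫ ξ in (-1 : ℝ)..1, ω ξ ^ (2 * p) * σ φ ^ p =
      1 / 2 * I * s := by
    simp_rw [intervalIntegral.integral_mul_const, intervalIntegral.integral_const_mul]
    rw [← hI, hs]
    field_simp
    ring
  rw [hlim]
  have hratio : Tendsto (fun ℓ : ℕ => (ℓ : ℝ) / ((ℓ : ℝ) + 1)) atTop (nhds 1) :=
    tendsto_natCast_div_add_atTop 1
  have hR : Tendsto (fun ℓ : ℕ => 1 / ((ℓ : ℝ) + 1) * (∑ j : Fin (ℓ - 1),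
      ω (node ℓ j) ^ (2 * p)) * s) atTop (nhds (1 / 2 * I * s)) := by
    have h := ((hratio.div_const 2).mul (tendsto_riemannSum_node hL hend)).mul_const s
    refine h.congr' ?_
    filter_upwards [eventually_ge_atTop 1] with ℓ hℓ
    have : (0 : ℝ) < ℓ := by exact_mod_cast hℓ
    field_simp
  have hRC := (Complex.continuous_ofReal.tendsto _).comp hR
  refine tendsto_of_tendsto_of_dist hRC (squeeze_zero (fun _ => dist_nonneg) (fun ℓ => ?_)
    (by simpa using hδ.abs))
  have hdiff : (1 / ((ℓ : ℝ) + 1) : ℂ) * Matrix.trace (Wmat ω σ ℓ ^ p)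
      - ((1 / ((ℓ : ℝ) + 1) * (∑ j : Fin (ℓ - 1), ω (node ℓ j) ^ (2 * p)) * s : ℝ) : ℂ) =
      ((1 / ((ℓ : ℝ) + 1) : ℝ) : ℂ) * ∑ j : Fin (ℓ - 1),
        ((Wmat ω σ ℓ ^ p) j j - ((ω (node ℓ j) ^ (2 * p) * s : ℝ) : ℂ)) := by
    rw [Finset.sum_sub_distrib, Matrix.trace, ← Complex.ofReal_sum, ← Finset.sum_mul]
    simp only [Matrix.diag_apply]
    push_cast
    ring
  rw [dist_comm, dist_eq_norm, Function.comp_apply, hdiff, norm_mul, Complex.norm_real,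
    Real.norm_of_nonneg (by positivity)]
  have hsum : ‖∑ j : Fin (ℓ - 1), ((Wmat ω σ ℓ ^ p) j j
      - ((ω (node ℓ j) ^ (2 * p) * s : ℝ) : ℂ))‖ ≤ ((ℓ : ℝ) + 1) * |δ ℓ| := by
    refine (norm_sum_le_of_le _ fun j _ => (hbound ℓ j).trans (le_abs_self _)).trans ?_
    rw [Finset.sum_const, card_univ, Fintype.card_fin, nsmul_eq_mul]
    gcongr
    exact_mod_cast (by omega : ℓ - 1 ≤ ℓ + 1)
  calc _ ≤ 1 / ((ℓ : ℝ) + 1) * (((ℓ : ℝ) + 1) * |δ ℓ|) := by gcongr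
    _ = |δ ℓ| := by field_simp
end
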